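/- arXiv:math/0610360 — 2 statements merged into one kernel-verified Lean document; each statement's English description precedes it below -/
import Mathlib

section
/- limsup_{n→∞} σ(n)/(n·log log n) = e^γ, where σ(n) is the sum of divisors of n and γ is Euler's constant. (Gronwall's theorem) -/
open Filter Real

open scoped Topology

namespace Mertens

open Finset
open Nat (primesLE mem_primesLE)

/-! ### Mertens' first theorem -/

lemma log_factorial_eq_sum_primesLE (N : ℕ) :
    log (N.factorial : ℝ) = ∑ p ∈ primesLE N, (N.factorial.factorization p : ℝ) * log p := by
  rw [log_nat_eq_sum_factorization, Finsupp.sum]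
  refine sum_subset (fun p hp ↦ ?_) fun p _ hp ↦ ?_
  · have hp' := Nat.prime_of_mem_primeFactors hp
    exact mem_primesLE.2 ⟨hp'.dvd_factorial.1 (Nat.dvd_of_mem_primeFactors hp), hp'⟩
  · simp [Finsupp.notMem_support_iff.1 hp]

lemma div_sub_one_le_factorization_factorial {N p : ℕ} (hp : p.Prime) (hpN : p ≤ N) :
    (N : ℝ) / p - 1 ≤ N.factorial.factorization p := by
  have h : N / p ≤ N.factorial.factorization p := by
    rw [Nat.factorization_factorial hp (Nat.lt_succ_self _)]
    have h1 : 1 ∈ Ico 1 (Nat.log p N + 1) :=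
      mem_Ico.2 ⟨le_rfl, Nat.lt_succ_of_le (Nat.log_pos hp.one_lt hpN)⟩
    simpa using single_le_sum (f := fun i ↦ N / p ^ i) (fun _ _ ↦ Nat.zero_le _) h1
  have h' : ((N / p : ℕ) : ℝ) ≤ N.factorial.factorization p := mod_cast h
  have h'' := Nat.lt_floor_add_one ((N : ℝ) / p)
  rw [Nat.floor_div_eq_div] at h''
  linarith

lemma factorization_factorial_le_div {N p : ℕ} (hp : p.Prime) :
    (N.factorial.factorization p : ℝ) ≤ N / (p - 1) := by
  have hp1 : (1 : ℝ) < p := mod_cast hp.one_lt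
  have := Fact.mk hp
  have h : (p - 1) * N.factorial.factorization p ≤ N := by
    rw [Nat.factorization_def _ hp, sub_one_mul_padicValNat_factorial]
    exact Nat.sub_le _ _
  rw [le_div_iff₀ (by linarith), mul_comm]
  have h' : (((p - 1 : ℕ) * N.factorial.factorization p : ℕ) : ℝ) ≤ N := mod_cast h
  rwa [Nat.cast_mul, Nat.cast_sub hp.one_le, Nat.cast_one] at h'

lemma log_div_mul_sub_one_nonneg (n : ℕ) : 0 ≤ log n / ((n : ℝ) * (n - 1)) := by
  rcases Nat.eq_zero_or_pos n with rfl | hn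
  · simp
  · have : (1 : ℝ) ≤ n := mod_cast hn
    exact div_nonneg (log_nonneg this) (mul_nonneg (by linarith) (by linarith))

lemma summable_log_div_mul_sub_one :
    Summable fun n : ℕ ↦ log n / ((n : ℝ) * (n - 1)) := by
  have h : Summable fun n : ℕ ↦ 4 * (1 / (n : ℝ) ^ (3 / 2 : ℝ)) :=
    (Real.summable_one_div_nat_rpow.2 (by norm_num)).mul_left 4
  refine h.of_nonneg_of_le log_div_mul_sub_one_nonneg fun n ↦ ?_
  rcases Nat.lt_or_ge n 2 with hn | hn
  · interval_cases n <;> simp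
  · have hn' : (2 : ℝ) ≤ n := mod_cast hn
    have h0 : (0 : ℝ) < n := by linarith
    have hlog : log n ≤ 2 * (n : ℝ) ^ (1 / 2 : ℝ) := by
      have := log_le_rpow_div h0.le (show (0 : ℝ) < 1 / 2 by norm_num)
      linarith
    have e : (n : ℝ) ^ 2 = (n : ℝ) ^ (1 / 2 : ℝ) * (n : ℝ) ^ (3 / 2 : ℝ) := by
      rw [← rpow_add h0]; norm_num
    rw [mul_one_div, div_le_div_iff₀ (by nlinarith) (by positivity)]
    calc log n * (n : ℝ) ^ (3 / 2 : ℝ)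
        ≤ 2 * (n : ℝ) ^ (1 / 2 : ℝ) * (n : ℝ) ^ (3 / 2 : ℝ) := by gcongr
      _ = 2 * (n : ℝ) ^ 2 := by rw [e]; ring
      _ ≤ 4 * (n * (n - 1)) := by nlinarith

/-- **Mertens' first theorem**. -/
theorem exists_abs_sum_log_div_sub_log_le :
    ∃ K : ℝ, ∀ N : ℕ, N ≠ 0 → |∑ p ∈ primesLE N, log p / p - log N| ≤ K := by
  refine ⟨max (log 4) (1 + ∑' n : ℕ, log n / ((n : ℝ) * (n - 1))), fun N hN ↦ ?_⟩
  have hN0 : (0 : ℝ) < N := mod_cast Nat.pos_of_ne_zero hN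
  have hN1 : (1 : ℝ) ≤ N := mod_cast Nat.one_le_iff_ne_zero.2 hN
  have hfac := log_factorial_eq_sum_primesLE N
  refine abs_sub_le_iff.2 ⟨le_max_of_le_left ?_, le_max_of_le_right ?_⟩
  · have hub : log (N.factorial : ℝ) ≤ N * log N := by
      rw [← log_pow]
      exact log_le_log (mod_cast N.factorial_pos) (mod_cast N.factorial_le_pow)
    have hθ : ∑ p ∈ primesLE N, log p ≤ log 4 * N := by
      rw [← Chebyshev.theta_eq_sum_primesLE_log]
      exact Chebyshev.theta_le_log4_mul_x hN0.le
    have hlb : ∑ p ∈ primesLE N, ((N : ℝ) * (log p / p) - log p) ≤ log (N.factorial : ℝ) := by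
      rw [hfac]
      refine sum_le_sum fun p hp ↦ ?_
      obtain ⟨hpN, hp⟩ := mem_primesLE.1 hp
      have := mul_le_mul_of_nonneg_right (div_sub_one_le_factorization_factorial hp hpN)
        (log_natCast_nonneg p)
      calc _ = ((N : ℝ) / p - 1) * log p := by ring
        _ ≤ _ := this
    rw [sum_sub_distrib, ← mul_sum] at hlb
    refine le_of_mul_le_mul_left ?_ hN0
    linarith
  · have hlb : N * log N - N ≤ log (N.factorial : ℝ) := by
      have h1 := Stirling.le_log_factorial_stirling hN
      have h2 := log_nonneg hN1
      have h3 : 0 ≤ log (2 * π) := log_nonneg (by linarith [pi_gt_three])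
      linarith
    have hub : log (N.factorial : ℝ) ≤
        ∑ p ∈ primesLE N, ((N : ℝ) * (log p / p) + N * (log p / ((p : ℝ) * (p - 1)))) := by
      rw [hfac]
      refine sum_le_sum fun p hp ↦ ?_
      obtain ⟨-, hp⟩ := mem_primesLE.1 hp
      have hp1 : (1 : ℝ) < p := mod_cast hp.one_lt
      refine (mul_le_mul_of_nonneg_right (factorization_factorial_le_div hp)
        (log_natCast_nonneg p)).trans_eq ?_
      have : (p : ℝ) - 1 ≠ 0 := by linarith
      field_simp
      ring
    rw [sum_add_distrib, ← mul_sum, ← mul_sum] at hub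
    have hs : ∑ p ∈ primesLE N, log p / ((p : ℝ) * (p - 1)) ≤
        ∑' n : ℕ, log n / ((n : ℝ) * (n - 1)) :=
      summable_log_div_mul_sub_one.sum_le_tsum _ fun n _ ↦ log_div_mul_sub_one_nonneg n
    have hs' := mul_le_mul_of_nonneg_left hs hN0.le
    refine le_of_mul_le_mul_left ?_ hN0
    linarith

/-! ### Mertens' second theorem -/

lemma sum_primesLE_succ (f : ℕ → ℝ) (N : ℕ) :
    ∑ p ∈ primesLE (N + 1), f p =
      ∑ p ∈ primesLE N, f p + if (N + 1).Prime then f (N + 1) else 0 := by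
  rw [Nat.primesLE_succ]
  split_ifs with h
  · rw [sum_insert (Nat.notMem_primesLE N), add_comm]
  · rw [add_zero]

lemma primesLE_two : primesLE 2 = {2} := by decide

lemma sum_range_prime_ite (f : ℕ → ℝ) (K : ℕ) :
    ∑ i ∈ range K, (if (i + 3).Prime then f (i + 3) else 0) =
      ∑ p ∈ primesLE (K + 2), f p - f 2 := by
  induction K with
  | zero => simp [primesLE_two]
  | succ K ih =>
    rw [sum_range_succ, ih, show K + 1 + 2 = K + 2 + 1 by ring, sum_primesLE_succ f (K + 2)]
    ring

lemma summable_log_sub_log_div_log :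
    Summable fun i : ℕ ↦ (log (i + 3 : ℕ) - log (i + 2 : ℕ)) / log (i + 3 : ℕ) -
      (log (log (i + 3 : ℕ)) - log (log (i + 2 : ℕ))) := by
  have h : Summable fun i : ℕ ↦ 1 / log 2 ^ 2 * (1 / ((i + 2 : ℕ) : ℝ) ^ 2) :=
    ((summable_nat_add_iff 2).2
      (Real.summable_one_div_nat_pow.2 (by norm_num : 1 < 2))).mul_left _
  refine h.of_norm_bounded fun i ↦ ?_
  have hm : (2 : ℝ) ≤ (i + 2 : ℕ) := by norm_cast; omega
  have hn : ((i + 3 : ℕ) : ℝ) = (i + 2 : ℕ) + 1 := by push_cast; ring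
  rw [hn]
  generalize ((i + 2 : ℕ) : ℝ) = m at hm
  have hl2 : 0 < log 2 := log_pos one_lt_two
  have hlm : log 2 ≤ log m := log_le_log two_pos hm
  have hlm1 : log m ≤ log (m + 1) := log_le_log (by linarith) (by linarith)
  set a := log m
  set b := log (m + 1)
  have ha : 0 < a := by linarith
  have hb : 0 < b := by linarith
  have hba : b - a ≤ 1 / m := by
    have h1 := log_le_sub_one_of_pos (show 0 < (m + 1) / m by positivity)
    rw [log_div (by linarith) (by linarith)] at h1
    have : (m + 1) / m - 1 = 1 / m := by field_simp; ring
    linarith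
  have h1 : log b - log a ≤ (b - a) / a := by
    have := log_le_sub_one_of_pos (div_pos hb ha)
    rw [log_div hb.ne' ha.ne'] at this
    have e : b / a - 1 = (b - a) / a := by field_simp
    linarith
  have h2 : (b - a) / b ≤ log b - log a := by
    have := one_sub_inv_le_log_of_pos (div_pos hb ha)
    rw [log_div hb.ne' ha.ne', inv_div] at this
    have e : 1 - a / b = (b - a) / b := by field_simp
    linarith
  rw [norm_eq_abs, abs_sub_comm, abs_of_nonneg (by linarith)]
  calc log b - log a - (b - a) / b ≤ (b - a) / a - (b - a) / b := by linarith
    _ = (b - a) ^ 2 / (a * b) := by field_simp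
    _ ≤ (1 / m) ^ 2 / (log 2 * log 2) := by
        have : 0 ≤ b - a := by linarith
        gcongr
        linarith
    _ = _ := by field_simp

lemma antitone_inv_log_add_three : Antitone fun i : ℕ ↦ (log (i + 3 : ℕ))⁻¹ := by
  intro i j hij
  have h3 : (1 : ℝ) < (i + 3 : ℕ) := by norm_cast; omega
  exact inv_anti₀ (log_pos h3) (log_le_log (by linarith) (by exact_mod_cast by omega))

/-- **Mertens' second theorem**. -/
theorem exists_tendsto_sum_inv_sub_log_log :
    ∃ C : ℝ, Tendsto (fun N : ℕ ↦ ∑ p ∈ primesLE N, (p : ℝ)⁻¹ - log (log N)) atTop (𝓝 C) := by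
  obtain ⟨K, hK⟩ := exists_abs_sum_log_div_sub_log_le
  let z : ℕ → ℝ := fun i ↦ (if (i + 3).Prime then log (i + 3 : ℕ) / (i + 3 : ℕ) else 0) -
    (log (i + 3 : ℕ) - log (i + 2 : ℕ))
  have hz : ∀ n, ‖∑ i ∈ range n, z i‖ ≤ K + |log 2 - log 2 / 2| := fun n ↦ by
    have e : ∑ i ∈ range n, z i =
        (∑ p ∈ primesLE (n + 2), log p / p - log (n + 2 : ℕ)) + (log 2 - log 2 / 2) := by
      rw [sum_sub_distrib, sum_range_prime_ite (fun p ↦ log p / p),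
        sum_range_sub (fun i : ℕ ↦ log (i + 2 : ℕ))]
      push_cast
      ring_nf
    rw [e, norm_eq_abs]
    exact (abs_add_le _ _).trans (add_le_add_left (hK _ (by omega)) _)
  have hlim : Tendsto (fun i : ℕ ↦ (log (i + 3 : ℕ))⁻¹) atTop (𝓝 0) :=
    tendsto_inv_atTop_zero.comp <| tendsto_log_atTop.comp <|
      tendsto_natCast_atTop_atTop.comp (tendsto_add_atTop_nat 3)
  obtain ⟨C₁, hC₁⟩ := cauchySeq_tendsto_of_complete <|
    antitone_inv_log_add_three.cauchySeq_series_mul_of_tendsto_zero_of_bounded hlim hz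
  have h := hC₁.add summable_log_sub_log_div_log.hasSum.tendsto_sum_nat
  refine ⟨_, (tendsto_add_atTop_iff_nat 2).1 <| (h.add_const (2⁻¹ - log (log 2))).congr fun n ↦ ?_⟩
  rw [← sum_add_distrib]
  have e : ∀ i : ℕ, (log (i + 3 : ℕ))⁻¹ • z i +
      ((log (i + 3 : ℕ) - log (i + 2 : ℕ)) / log (i + 3 : ℕ) -
        (log (log (i + 3 : ℕ)) - log (log (i + 2 : ℕ)))) =
      (if (i + 3).Prime then ((i + 3 : ℕ) : ℝ)⁻¹ else 0) -
        (log (log (i + 3 : ℕ)) - log (log (i + 2 : ℕ))) := fun i ↦ by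
    have h3 : (1 : ℝ) < (i + 3 : ℕ) := by norm_cast; omega
    have : log (i + 3 : ℕ) ≠ 0 := (log_pos h3).ne'
    simp only [z, smul_eq_mul]
    split_ifs
    · field_simp
      ring
    · field_simp
      ring
  rw [sum_congr rfl fun i _ ↦ e i, sum_sub_distrib, sum_range_prime_ite (fun p ↦ (p : ℝ)⁻¹),
    sum_range_sub (fun i : ℕ ↦ log (log (i + 2 : ℕ)))]
  push_cast
  ring_nf

/-! ### The prime zeta function near `1` -/

lemma neg_log_one_sub_sub_self_nonneg {y : ℝ} (h1 : y < 1) : 0 ≤ -log (1 - y) - y := by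
  have := log_le_sub_one_of_pos (show 0 < 1 - y by linarith)
  linarith

lemma neg_log_one_sub_sub_self_le {y : ℝ} (h1 : y ≤ 1 / 2) :
    -log (1 - y) - y ≤ 2 * y ^ 2 := by
  have hy : 0 < 1 - y := by linarith
  have := one_sub_inv_le_log_of_pos hy
  have e : (1 - y)⁻¹ - 1 - y = y ^ 2 / (1 - y) := by field_simp; ring
  have : y ^ 2 / (1 - y) ≤ 2 * y ^ 2 := by
    rw [div_le_iff₀ hy]
    nlinarith [sq_nonneg y]
  linarith

lemma rpow_neg_prime_le_half (p : Nat.Primes) {s : ℝ} (hs : 1 ≤ s) :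
    (p : ℝ) ^ (-s) ≤ 1 / 2 := by
  have hp : (2 : ℝ) ≤ p := mod_cast p.2.two_le
  calc (p : ℝ) ^ (-s) ≤ (p : ℝ) ^ (-1 : ℝ) :=
        rpow_le_rpow_of_exponent_le (by linarith) (by linarith)
    _ = (p : ℝ)⁻¹ := rpow_neg_one _
    _ ≤ 1 / 2 := by rw [one_div]; exact inv_anti₀ two_pos hp

/-- The sum over all primes of the higher order terms in the expansion of `-log (1 - 1 / p)`. -/
noncomputable def higherSum : ℝ := ∑' p : Nat.Primes, (-log (1 - (p : ℝ)⁻¹) - (p : ℝ)⁻¹)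

lemma norm_neg_log_one_sub_rpow_le (p : Nat.Primes) {s : ℝ} (hs : 1 ≤ s) :
    ‖-log (1 - (p : ℝ) ^ (-s)) - (p : ℝ) ^ (-s)‖ ≤ 2 * (p : ℝ) ^ (-2 : ℝ) := by
  have hp : (2 : ℝ) ≤ p := mod_cast p.2.two_le
  have h := rpow_neg_prime_le_half p hs
  rw [norm_eq_abs, abs_of_nonneg (neg_log_one_sub_sub_self_nonneg (by linarith))]
  refine (neg_log_one_sub_sub_self_le h).trans ?_
  gcongr
  rw [← rpow_natCast, ← rpow_mul (by linarith)]
  exact rpow_le_rpow_of_exponent_le (by linarith) (by push_cast; linarith)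

lemma summable_two_mul_rpow_neg_two : Summable fun p : Nat.Primes ↦ 2 * (p : ℝ) ^ (-2 : ℝ) :=
  (Nat.Primes.summable_rpow.2 (by norm_num)).mul_left 2

lemma hasSum_higherSum :
    HasSum (fun p : Nat.Primes ↦ -log (1 - (p : ℝ)⁻¹) - (p : ℝ)⁻¹) higherSum :=
  (summable_two_mul_rpow_neg_two.of_norm_bounded fun p ↦ by
    simpa only [rpow_neg_one] using norm_neg_log_one_sub_rpow_le p le_rfl).hasSum

lemma tendsto_tsum_neg_log_one_sub_rpow :
    Tendsto (fun s : ℝ ↦ ∑' p : Nat.Primes, (-log (1 - (p : ℝ) ^ (-s)) - (p : ℝ) ^ (-s)))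
      (𝓝[>] 1) (𝓝 higherSum) := by
  refine tendsto_tsum_of_dominated_convergence summable_two_mul_rpow_neg_two (fun p ↦ ?_) ?_
  · have hp : (2 : ℝ) ≤ p := mod_cast p.2.two_le
    have hc : ContinuousAt (fun s : ℝ ↦ (p : ℝ) ^ (-s)) 1 :=
      (continuousAt_const_rpow (by linarith)).comp continuous_neg.continuousAt
    have hne : 1 - (p : ℝ) ^ (-1 : ℝ) ≠ 0 := by linarith [rpow_neg_prime_le_half p le_rfl]
    have := (((continuousAt_const.sub hc).log hne).neg.sub hc).tendsto
    show Tendsto _ _ (𝓝 (-log (1 - (p : ℝ)⁻¹) - (p : ℝ)⁻¹))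
    rw [← rpow_neg_one]
    exact this.mono_left nhdsWithin_le_nhds
  · filter_upwards [self_mem_nhdsWithin] with s hs p
    exact norm_neg_log_one_sub_rpow_le p (le_of_lt hs)

lemma hasProd_inv_one_sub_rpow {s : ℝ} (hs : 1 < s) :
    HasProd (fun p : Nat.Primes ↦ (1 - (p : ℝ) ^ (-s))⁻¹) (∑' n : ℕ, 1 / (n : ℝ) ^ s) := by
  let f : ℕ →*₀ ℝ :=
    { toFun := fun n ↦ (n : ℝ) ^ (-s)
      map_zero' := by simp [zero_rpow (show -s ≠ 0 by linarith)]
      map_one' := by simp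
      map_mul' := fun m n ↦ by
        push_cast
        exact mul_rpow (Nat.cast_nonneg _) (Nat.cast_nonneg _) }
  have hf : ∀ n, f n = (n : ℝ) ^ (-s) := fun _ ↦ rfl
  have hsum : Summable (‖f ·‖) := by
    simp only [hf]
    exact (Real.summable_nat_rpow.2 (by linarith)).norm
  have := EulerProduct.eulerProduct_completely_multiplicative_hasProd hsum
  simp only [hf] at this
  simpa only [one_div, ← rpow_neg (Nat.cast_nonneg _)] using this

lemma log_tsum_one_div_rpow {s : ℝ} (hs : 1 < s) :
    log (∑' n : ℕ, 1 / (n : ℝ) ^ s) = ∑' p : Nat.Primes, (p : ℝ) ^ (-s) +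
      ∑' p : Nat.Primes, (-log (1 - (p : ℝ) ^ (-s)) - (p : ℝ) ^ (-s)) := by
  have hpos : 0 < ∑' n : ℕ, 1 / (n : ℝ) ^ s :=
    (Real.summable_one_div_nat_rpow.2 hs).tsum_pos (fun _ ↦ by positivity) 1 (by simp)
  have h1 : HasSum (fun p : Nat.Primes ↦ -log (1 - (p : ℝ) ^ (-s)))
      (log (∑' n : ℕ, 1 / (n : ℝ) ^ s)) := by
    refine Tendsto.congr (fun t ↦ ?_) ((hasProd_inv_one_sub_rpow hs).log hpos.ne')
    rw [log_prod fun p _ ↦ inv_ne_zero (by linarith [rpow_neg_prime_le_half p hs.le])]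
    simp
  have h2 : Summable fun p : Nat.Primes ↦ (p : ℝ) ^ (-s) :=
    Nat.Primes.summable_rpow.2 (by linarith)
  rw [(h1.summable.tsum_sub h2), h1.tsum_eq]
  ring

lemma tendsto_tsum_primes_rpow_add_log :
    Tendsto (fun s : ℝ ↦ ∑' p : Nat.Primes, (p : ℝ) ^ (-s) + log (s - 1)) (𝓝[>] 1)
      (𝓝 (-higherSum)) := by
  have h := (tendsto_sub_mul_tsum_nat_rpow.log one_ne_zero).sub tendsto_tsum_neg_log_one_sub_rpow
  rw [log_one, zero_sub] at h
  refine h.congr' ?_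
  filter_upwards [self_mem_nhdsWithin] with s hs
  have hs : 1 < s := hs
  have hpos : 0 < ∑' n : ℕ, 1 / (n : ℝ) ^ s :=
    (Real.summable_one_div_nat_rpow.2 hs).tsum_pos (fun _ ↦ by positivity) 1 (by simp)
  rw [log_mul (by linarith) hpos.ne', log_tsum_one_div_rpow hs]
  ring

/-! ### The constant in Mertens' second theorem -/

/-- The primes in `(2 ^ k, 2 ^ (k + 1)]`. -/
def dyadicPrimes (k : ℕ) : Finset ℕ := {p ∈ Ioc (2 ^ k) (2 ^ (k + 1)) | p.Prime}

lemma sum_range_dyadicPrimes (g : ℕ → ℝ) (K : ℕ) :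
    ∑ k ∈ range K, ∑ p ∈ dyadicPrimes k, g p = ∑ p ∈ primesLE (2 ^ K), g p := by
  simp only [dyadicPrimes, Nat.primesLE_eq_filter_Ioc_one, sum_filter]
  induction K with
  | zero => simp
  | succ K ih =>
    rw [sum_range_succ, ih, sum_Ioc_consecutive _ Nat.one_le_two_pow
      (Nat.pow_le_pow_right two_pos K.le_succ)]

lemma tendsto_sum_primesLE_of_hasSum {g : ℕ → ℝ} {S : ℝ}
    (h : HasSum (fun p : Nat.Primes ↦ g p) S) :
    Tendsto (fun N ↦ ∑ p ∈ primesLE N, g p) atTop (𝓝 S) := by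
  have h' : HasSum ({p : ℕ | p.Prime}.indicator g) S := hasSum_subtype_iff_indicator.1 h
  refine (h'.tendsto_sum_nat.comp (tendsto_add_atTop_nat 1)).congr fun N ↦ ?_
  rw [Nat.primesLE_eq_filter_range, sum_filter]
  exact sum_congr rfl fun n _ ↦ by simp [Set.indicator_apply]

lemma hasSum_dyadicPrimes {g : ℕ → ℝ} (hg : ∀ n, 0 ≤ g n) {P : ℝ}
    (h : HasSum (fun p : Nat.Primes ↦ g p) P) :
    HasSum (fun k ↦ ∑ p ∈ dyadicPrimes k, g p) P := by
  rw [hasSum_iff_tendsto_nat_of_nonneg fun k ↦ sum_nonneg fun p _ ↦ hg p]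
  refine ((tendsto_sum_primesLE_of_hasSum h).comp
    (tendsto_pow_atTop_atTop_of_one_lt (r := 2) one_lt_two)).congr fun K ↦ ?_
  rw [sum_range_dyadicPrimes, Function.comp_apply]

lemma dyadic_term_bounds {s : ℝ} (hs : 1 < s) (k : ℕ) :
    (∑ p ∈ dyadicPrimes k, (p : ℝ)⁻¹) * ((2 : ℝ) ^ (1 - s)) ^ (k + 1) ≤
        ∑ p ∈ dyadicPrimes k, (p : ℝ) ^ (-s) ∧
      (2 : ℝ) ^ (1 - s) * ∑ p ∈ dyadicPrimes k, (p : ℝ) ^ (-s) ≤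
        (∑ p ∈ dyadicPrimes k, (p : ℝ)⁻¹) * ((2 : ℝ) ^ (1 - s)) ^ (k + 1) := by
  have e : ∀ j : ℕ, ((2 : ℝ) ^ (1 - s)) ^ j = ((2 : ℝ) ^ j) ^ (1 - s) := fun j ↦ by
    rw [← rpow_natCast, ← rpow_natCast, ← rpow_mul two_pos.le, ← rpow_mul two_pos.le, mul_comm]
  have key : ∀ p ∈ dyadicPrimes k, 0 < (p : ℝ) ∧ (2 : ℝ) ^ k ≤ p ∧ (p : ℝ) ≤ 2 ^ (k + 1) ∧
      (p : ℝ) ^ (-s) = (p : ℝ)⁻¹ * (p : ℝ) ^ (1 - s) := fun p hp ↦ by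
    simp only [dyadicPrimes, mem_filter, mem_Ioc] at hp
    have h0 : (0 : ℝ) < p := mod_cast hp.2.pos
    refine ⟨h0, mod_cast hp.1.1.le, mod_cast hp.1.2, ?_⟩
    rw [← rpow_neg_one, ← rpow_add h0]
    ring_nf
  rw [sum_mul, mul_sum]
  constructor <;> refine sum_le_sum fun p hp ↦ ?_
  · obtain ⟨h0, -, h2, h3⟩ := key p hp
    rw [h3, e]
    exact mul_le_mul_of_nonneg_left (rpow_le_rpow_of_nonpos h0 h2 (by linarith)) (by positivity)
  · obtain ⟨h0, h1, -, h3⟩ := key p hp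
    rw [h3, pow_succ, e, mul_left_comm, mul_comm _ ((2 : ℝ) ^ (1 - s))]
    have := rpow_le_rpow_of_nonpos (by positivity) h1 (show 1 - s ≤ 0 by linarith)
    gcongr

lemma tendsto_log_one_sub_two_rpow_sub_log :
    Tendsto (fun s : ℝ ↦ log (1 - (2 : ℝ) ^ (1 - s)) - log (s - 1)) (𝓝[>] 1)
      (𝓝 (log (log 2))) := by
  have hl2 : 0 < log 2 := log_pos one_lt_two
  have hd : HasDerivAt (fun s : ℝ ↦ 1 - (2 : ℝ) ^ (1 - s)) (log 2) 1 := by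
    have := (((hasDerivAt_id (1 : ℝ)).const_sub 1).const_rpow (a := 2) two_pos).const_sub 1
    simpa using this
  have h := (hd.tendsto_slope.mono_left
    (nhdsWithin_mono _ fun s (hs : 1 < s) ↦ hs.ne' : 𝓝[>] (1 : ℝ) ≤ 𝓝[≠] 1)).log hl2.ne'
  refine h.congr' ?_
  filter_upwards [self_mem_nhdsWithin] with s hs
  have hs : 1 < s := hs
  have h1 : (2 : ℝ) ^ (1 - s) < 1 := rpow_lt_one_of_one_lt_of_neg one_lt_two (by linarith)
  rw [slope_def_field, log_div _ (by linarith)]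
  · simp
  · simpa using (by linarith : 1 - (2 : ℝ) ^ (1 - s) ≠ 0)

lemma tendsto_two_rpow_one_sub : Tendsto (fun s : ℝ ↦ (2 : ℝ) ^ (1 - s)) (𝓝[>] 1) (𝓝[<] 1) := by
  refine tendsto_nhdsWithin_iff.2 ⟨?_, ?_⟩
  · have : ContinuousAt (fun s : ℝ ↦ (2 : ℝ) ^ (1 - s)) 1 :=
      (continuousAt_const_rpow two_ne_zero).comp (continuous_const.sub continuous_id).continuousAt
    have h := this.tendsto
    simp only [sub_self, rpow_zero] at h
    exact h.mono_left nhdsWithin_le_nhds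
  · filter_upwards [self_mem_nhdsWithin] with s hs
    exact rpow_lt_one_of_one_lt_of_neg one_lt_two (by linarith [show 1 < s from hs])

lemma tendsto_one_sub_two_rpow_mul_tsum :
    Tendsto (fun s : ℝ ↦ (1 - (2 : ℝ) ^ (1 - s)) * ∑' p : Nat.Primes, (p : ℝ) ^ (-s))
      (𝓝[>] 1) (𝓝 0) := by
  have h0 : Tendsto (fun s : ℝ ↦ 1 - (2 : ℝ) ^ (1 - s)) (𝓝[>] 1) (𝓝 0) := by
    simpa using (tendsto_two_rpow_one_sub.mono_right nhdsWithin_le_nhds).const_sub 1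
  have h1 := (tendsto_tsum_primes_rpow_add_log.add tendsto_log_one_sub_two_rpow_sub_log).mul h0
  have h2 := (continuous_mul_log.tendsto 0).comp h0
  have h := h1.sub h2
  rw [mul_zero, zero_mul, sub_zero] at h
  refine h.congr fun s ↦ ?_
  simp only [Function.comp_apply]
  ring

theorem add_higherSum_eq_eulerMascheroniConstant {C : ℝ}
    (hC : Tendsto (fun N : ℕ ↦ ∑ p ∈ primesLE N, (p : ℝ)⁻¹ - log (log N)) atTop (𝓝 C)) :
    C + higherSum = eulerMascheroniConstant := by
  set d : ℕ → ℝ := fun k ↦ ∑ p ∈ dyadicPrimes k, (p : ℝ)⁻¹ - 1 / ((k : ℝ) + 1)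
  have hd : Tendsto (fun K ↦ ∑ k ∈ range K, d k) atTop
      (𝓝 (C + log (log 2) - eulerMascheroniConstant)) := by
    have h := ((hC.comp (tendsto_pow_atTop_atTop_of_one_lt (r := 2) one_lt_two)).add_const
      (log (log 2))).sub tendsto_harmonic_sub_log
    refine h.congr' ?_
    filter_upwards [eventually_gt_atTop 0] with K hK
    have hl2 : 0 < log 2 := log_pos one_lt_two
    have hK' : (0 : ℝ) < K := mod_cast hK
    rw [sum_sub_distrib, sum_range_dyadicPrimes (fun p ↦ (p : ℝ)⁻¹)]
    simp only [Function.comp_apply, Nat.cast_pow, Nat.cast_ofNat, log_pow, harmonic, one_div]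
    rw [log_mul hK'.ne' hl2.ne']
    push_cast
    ring
  have habel := (Real.tendsto_tsum_powerSeries_nhdsWithin_lt hd).comp tendsto_two_rpow_one_sub
  have hr := tendsto_two_rpow_one_sub.mono_right nhdsWithin_le_nhds
  have hlim := habel.mul hr
  rw [mul_one] at hlim
  have hP := tendsto_tsum_primes_rpow_add_log.add tendsto_log_one_sub_two_rpow_sub_log
  have hdiff : Tendsto (fun s : ℝ ↦ (∑' p : Nat.Primes, (p : ℝ) ^ (-s) + log (s - 1) +
      (log (1 - (2 : ℝ) ^ (1 - s)) - log (s - 1))) -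
      ((fun x ↦ ∑' n, d n * x ^ n) ∘ fun s ↦ (2 : ℝ) ^ (1 - s)) s * (2 : ℝ) ^ (1 - s))
      (𝓝[>] 1) (𝓝 0) := by
    refine tendsto_of_tendsto_of_tendsto_of_le_of_le' tendsto_const_nhds
      tendsto_one_sub_two_rpow_mul_tsum ?_ ?_ <;>
    · filter_upwards [self_mem_nhdsWithin] with s hs
      have hs : 1 < s := hs
      have hq := hasSum_dyadicPrimes (g := fun n ↦ (n : ℝ) ^ (-s)) (fun n ↦ by positivity)
        (Nat.Primes.summable_rpow.2 (by linarith : -s < -1)).hasSum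
      have hb := dyadic_term_bounds hs
      set r : ℝ := (2 : ℝ) ^ (1 - s)
      have hr0 : 0 < r := by positivity
      have hr1 : r < 1 := rpow_lt_one_of_one_lt_of_neg one_lt_two (by linarith)
      have hG : Summable fun k ↦ (∑ p ∈ dyadicPrimes k, (p : ℝ)⁻¹) * r ^ (k + 1) :=
        hq.summable.of_nonneg_of_le (fun k ↦ by positivity) fun k ↦ (hb k).1
      have hle := hasSum_le (fun k ↦ (hb k).1) hG.hasSum hq
      have hge := hasSum_le (fun k ↦ (hb k).2) (hq.mul_left r) hG.hasSum
      have hlog := hasSum_pow_div_log_of_abs_lt_one (abs_lt.2 ⟨by linarith, hr1⟩)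
      have hsum : (∑' n, d n * r ^ n) * r =
          ∑' k, (∑ p ∈ dyadicPrimes k, (p : ℝ)⁻¹) * r ^ (k + 1) + log (1 - r) := by
        rw [← tsum_mul_right, ← sub_neg_eq_add, ← (hG.hasSum.sub hlog).tsum_eq]
        refine tsum_congr fun k ↦ ?_
        simp only [d]
        ring
      simp only [Function.comp_apply]
      rw [hsum]
      linarith
  have h := tendsto_nhds_unique (hdiff.congr fun _ ↦ rfl) (hP.sub hlim)
  linarith

/-! ### Mertens' third theorem -/

lemma inv_one_sub_inv_pos {p : ℕ} (hp : p.Prime) : 0 < (1 - (p : ℝ)⁻¹)⁻¹ :=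
  inv_pos.2 <| sub_pos.2 <| inv_lt_one_of_one_lt₀ <| mod_cast hp.one_lt

/-- **Mertens' third theorem**. -/
theorem tendsto_prod_inv_one_sub_inv_div_log :
    Tendsto (fun N : ℕ ↦ (∏ p ∈ primesLE N, (1 - (p : ℝ)⁻¹)⁻¹) / log N) atTop
      (𝓝 (exp eulerMascheroniConstant)) := by
  obtain ⟨C, hC⟩ := exists_tendsto_sum_inv_sub_log_log
  have h := (continuous_exp.tendsto _).comp <| hC.add <|
    tendsto_sum_primesLE_of_hasSum (g := fun p ↦ -log (1 - (p : ℝ)⁻¹) - (p : ℝ)⁻¹) hasSum_higherSum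
  rw [add_higherSum_eq_eulerMascheroniConstant hC] at h
  refine h.congr' ?_
  filter_upwards [eventually_gt_atTop 1] with N hN
  have hlog : 0 < log N := log_pos (mod_cast hN)
  rw [Function.comp_apply, sum_sub_distrib,
    show ∀ a b c : ℝ, a - b + (c - a) = c - b by intros; ring, exp_sub, exp_log hlog, exp_sum]
  congr 1
  refine prod_congr rfl fun p hp ↦ ?_
  rw [← log_inv, exp_log (inv_one_sub_inv_pos (mem_primesLE.1 hp).2)]

/-! ### Bounds for the sum of divisors -/

lemma one_le_inv_one_sub_inv {p : ℕ} (hp : p.Prime) : 1 ≤ (1 - (p : ℝ)⁻¹)⁻¹ := by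
  rw [one_le_inv₀ (inv_pos.1 (inv_one_sub_inv_pos hp))]
  have : 0 ≤ (p : ℝ)⁻¹ := by positivity
  linarith

lemma sum_divisors_eq_mul_prod {n : ℕ} (hn : n ≠ 0) :
    ((∑ d ∈ n.divisors, d : ℕ) : ℝ) = n * ∏ p ∈ n.primeFactors,
      ((1 - (p : ℝ)⁻¹ ^ (n.factorization p + 1)) * (1 - (p : ℝ)⁻¹)⁻¹) := by
  have e : (n : ℝ) = ∏ p ∈ n.primeFactors, (p : ℝ) ^ n.factorization p := by
    conv_lhs => rw [← Nat.prod_factorization_pow_eq_self hn]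
    rw [Finsupp.prod]
    push_cast
    rfl
  rw [Nat.sum_divisors hn]
  conv_rhs => rw [e, ← prod_mul_distrib]
  push_cast
  refine prod_congr rfl fun p hp ↦ ?_
  have hp := Nat.prime_of_mem_primeFactors hp
  have hp1 : (1 : ℝ) < p := mod_cast hp.one_lt
  have h1 : (p : ℝ) - 1 ≠ 0 := by linarith
  have h2 : (1 - (p : ℝ)⁻¹) ≠ 0 := (inv_pos.1 (inv_one_sub_inv_pos hp)).ne'
  rw [geom_sum_eq hp1.ne', div_eq_iff h1, inv_pow, pow_succ]
  field_simp

lemma sum_divisors_le_mul_prod {n : ℕ} (hn : n ≠ 0) :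
    ((∑ d ∈ n.divisors, d : ℕ) : ℝ) ≤ n * ∏ p ∈ n.primeFactors, (1 - (p : ℝ)⁻¹)⁻¹ := by
  rw [sum_divisors_eq_mul_prod hn]
  refine mul_le_mul_of_nonneg_left (prod_le_prod (fun p hp ↦ ?_) fun p hp ↦ ?_) n.cast_nonneg
  all_goals
    have hp := Nat.prime_of_mem_primeFactors hp
    have h0 := inv_one_sub_inv_pos hp
    have h1 : (p : ℝ)⁻¹ ^ (n.factorization p + 1) ≤ 1 :=
      pow_le_one₀ (by positivity) (inv_le_one_of_one_le₀ (mod_cast hp.one_le))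
    have h2 : 0 ≤ (p : ℝ)⁻¹ ^ (n.factorization p + 1) := by positivity
  · exact mul_nonneg (by linarith) h0.le
  · exact mul_le_of_le_one_left h0.le (by linarith)

lemma prod_small_primeFactors_le (n m : ℕ) :
    ∏ p ∈ n.primeFactors with p ≤ m, (1 - (p : ℝ)⁻¹)⁻¹ ≤
      ∏ p ∈ primesLE m, (1 - (p : ℝ)⁻¹)⁻¹ := by
  have hsub : {p ∈ n.primeFactors | p ≤ m} ⊆ primesLE m := fun p hp ↦ by
    rw [mem_filter] at hp
    exact mem_primesLE.2 ⟨hp.2, Nat.prime_of_mem_primeFactors hp.1⟩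
  rw [← prod_sdiff hsub]
  refine le_mul_of_one_le_left (prod_nonneg fun p hp ↦ ?_) ?_
  · exact (inv_one_sub_inv_pos (mem_primesLE.1 (hsub hp)).2).le
  · exact prod_const_one.symm.trans_le <| Finset.prod_le_prod (fun _ _ ↦ zero_le_one) fun p hp ↦
      one_le_inv_one_sub_inv (mem_primesLE.1 (mem_sdiff.1 hp).1).2

lemma card_large_primeFactors_mul_log_le {n : ℕ} (hn : n ≠ 0) (m : ℕ) :
    (#{p ∈ n.primeFactors | ¬ p ≤ m} : ℝ) * log (m + 1) ≤ log n := by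
  have h : (m + 1) ^ #{p ∈ n.primeFactors | ¬ p ≤ m} ≤ n :=
    calc (m + 1) ^ #{p ∈ n.primeFactors | ¬ p ≤ m}
        ≤ ∏ p ∈ n.primeFactors with ¬ p ≤ m, p := by
          rw [← prod_const]
          exact prod_le_prod (fun _ _ ↦ Nat.zero_le _) fun p hp ↦ not_le.1 (mem_filter.1 hp).2
      _ ≤ n := Nat.le_of_dvd (Nat.pos_of_ne_zero hn) <|
          (prod_dvd_prod_of_subset _ _ _ (filter_subset _ _)).trans n.prod_primeFactors_dvd
  rw [← log_pow]
  exact log_le_log (by positivity) (mod_cast h)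

lemma prod_large_primeFactors_le {n m : ℕ} (hm : 2 ≤ m) (hn : n ≠ 0) (hnm : log n ≤ m + 1) :
    ∏ p ∈ n.primeFactors with ¬ p ≤ m, (1 - (p : ℝ)⁻¹)⁻¹ ≤ exp (2 / log m) := by
  have hm' : (2 : ℝ) ≤ m := mod_cast hm
  have hm0 : (0 : ℝ) < m := by linarith
  have hlog : 0 < log m := log_pos (by linarith)
  have hfac : ∀ p ∈ {p ∈ n.primeFactors | ¬ p ≤ m}, (1 - (p : ℝ)⁻¹)⁻¹ ≤ exp (1 / m) :=
    fun p hp ↦ by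
      have hpm : ((m + 1 : ℕ) : ℝ) ≤ p := mod_cast not_le.1 (mem_filter.1 hp).2
      push_cast at hpm
      have hp0 : (0 : ℝ) < p := by linarith
      have hp1 : (p : ℝ) - 1 ≠ 0 := by linarith
      calc (1 - (p : ℝ)⁻¹)⁻¹ = 1 / (p - 1) + 1 := by field_simp; ring
        _ ≤ 1 / m + 1 := by gcongr; linarith
        _ ≤ exp (1 / m) := add_one_le_exp _
  calc ∏ p ∈ n.primeFactors with ¬ p ≤ m, (1 - (p : ℝ)⁻¹)⁻¹
      ≤ ∏ _p ∈ n.primeFactors with ¬ _p ≤ m, exp (1 / m) :=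
        prod_le_prod (fun p hp ↦ (inv_one_sub_inv_pos
          (Nat.prime_of_mem_primeFactors (mem_filter.1 hp).1)).le) hfac
    _ = exp (#{p ∈ n.primeFactors | ¬ p ≤ m} * (1 / m)) := by rw [prod_const, ← exp_nat_mul]
    _ ≤ exp (2 / log m) := by
        refine exp_le_exp.2 ?_
        have h1 := card_large_primeFactors_mul_log_le hn m
        have h2 : log m ≤ log (m + 1) := log_le_log hm0 (by linarith)
        rw [mul_one_div, div_le_div_iff₀ hm0 hlog]
        have h3 := mul_le_mul_of_nonneg_left h2
          (Nat.cast_nonneg (α := ℝ) #{p ∈ n.primeFactors | ¬ p ≤ m})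
        linarith

lemma sum_divisors_div_le {n : ℕ} (hn : n ≠ 0) (hm : 2 ≤ ⌊log n⌋₊) :
    ((∑ d ∈ n.divisors, d : ℕ) : ℝ) / (n * log (log n)) ≤
      (∏ p ∈ primesLE ⌊log n⌋₊, (1 - (p : ℝ)⁻¹)⁻¹) / log ⌊log n⌋₊ * exp (2 / log ⌊log n⌋₊) := by
  have hle : (⌊log n⌋₊ : ℝ) ≤ log n := Nat.floor_le (log_natCast_nonneg n)
  have hlt : log n ≤ ⌊log n⌋₊ + 1 := (Nat.lt_floor_add_one _).le
  generalize ⌊log n⌋₊ = m at *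
  have hm' : (2 : ℝ) ≤ m := mod_cast hm
  have hlog : 0 < log m := log_pos (by linarith)
  have hll : log m ≤ log (log n) := log_le_log (by linarith) hle
  have hn0 : (0 : ℝ) < n := mod_cast Nat.pos_of_ne_zero hn
  have hM : 0 ≤ ∏ p ∈ primesLE m, (1 - (p : ℝ)⁻¹)⁻¹ :=
    prod_nonneg fun p hp ↦ (inv_one_sub_inv_pos (mem_primesLE.1 hp).2).le
  have hprod : ∏ p ∈ n.primeFactors, (1 - (p : ℝ)⁻¹)⁻¹ ≤
      (∏ p ∈ primesLE m, (1 - (p : ℝ)⁻¹)⁻¹) * exp (2 / log m) := by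
    rw [← prod_filter_mul_prod_filter_not n.primeFactors (· ≤ m)]
    exact mul_le_mul (prod_small_primeFactors_le n m) (prod_large_primeFactors_le hm hn hlt)
      (prod_nonneg fun p hp ↦ (inv_one_sub_inv_pos
        (Nat.prime_of_mem_primeFactors (mem_filter.1 hp).1)).le) hM
  calc ((∑ d ∈ n.divisors, d : ℕ) : ℝ) / (n * log (log n))
      ≤ (n * ((∏ p ∈ primesLE m, (1 - (p : ℝ)⁻¹)⁻¹) * exp (2 / log m))) / (n * log m) := by
        have h := (sum_divisors_le_mul_prod hn).trans (mul_le_mul_of_nonneg_left hprod hn0.le)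
        gcongr
    _ = _ := by field_simp

/-! ### A sequence attaining the upper limit -/

/-- A power of the primorial of `N` whose exponent is of order `log N`. -/
def extremalNumber (N : ℕ) : ℕ := primorial N ^ (2 * Nat.log 2 N + 1)

lemma extremalNumber_ne_zero (N : ℕ) : extremalNumber N ≠ 0 := pow_ne_zero _ (primorial_ne_zero N)

lemma le_extremalNumber (N : ℕ) : N ≤ extremalNumber N :=
  le_primorial_self.trans (Nat.le_self_pow (by omega) _)

lemma primeFactors_extremalNumber (N : ℕ) : (extremalNumber N).primeFactors = primesLE N := by
  rw [extremalNumber, Nat.primeFactors_pow _ (by omega), primeFactors_primorial]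

lemma factorization_extremalNumber {N p : ℕ} (hp : p ∈ primesLE N) :
    (extremalNumber N).factorization p = 2 * Nat.log 2 N + 1 := by
  obtain ⟨hpN, hp⟩ := mem_primesLE.1 hp
  have h1 := (squarefree_primorial N).natFactorization_le_one p
  have h2 := hp.factorization_pos_of_dvd (primorial_ne_zero N) (hp.dvd_primorial_iff.2 hpN)
  have h : (primorial N).factorization p = 1 := by omega
  simp [extremalNumber, Nat.factorization_pow, h]

lemma one_sub_inv_mul_prod_le_sum_divisors_extremalNumber {N : ℕ} (hN : N ≠ 0) :
    (1 - (N : ℝ)⁻¹) * ∏ p ∈ primesLE N, (1 - (p : ℝ)⁻¹)⁻¹ ≤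
      ((∑ d ∈ (extremalNumber N).divisors, d : ℕ) : ℝ) / extremalNumber N := by
  have hN1 : (1 : ℝ) ≤ N := mod_cast Nat.one_le_iff_ne_zero.2 hN
  have hn : (extremalNumber N : ℝ) ≠ 0 := mod_cast extremalNumber_ne_zero N
  have hinv : (N : ℝ)⁻¹ ^ 2 ≤ 1 := pow_le_one₀ (by positivity) (inv_le_one_of_one_le₀ hN1)
  have hpow : ∀ p ∈ primesLE N,
      (p : ℝ)⁻¹ ^ ((extremalNumber N).factorization p + 1) ≤ (N : ℝ)⁻¹ ^ 2 := fun p hp ↦ by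
    have h : N ≤ p ^ (Nat.log 2 N + 1) :=
      (Nat.lt_pow_succ_log_self one_lt_two N).le.trans
        (Nat.pow_le_pow_left (mem_primesLE.1 hp).2.two_le _)
    have h' : (N : ℝ) ≤ (p : ℝ) ^ (Nat.log 2 N + 1) := mod_cast h
    rw [factorization_extremalNumber hp, show 2 * Nat.log 2 N + 1 + 1 = (Nat.log 2 N + 1) * 2 by
      ring, pow_mul, inv_pow]
    gcongr
  have hcard : #(primesLE N) ≤ N := by
    rw [Nat.primesLE_eq_filter_Ioc_zero]
    exact (card_filter_le _ _).trans (by simp)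
  rw [sum_divisors_eq_mul_prod (extremalNumber_ne_zero N), mul_div_cancel_left₀ _ hn,
    primeFactors_extremalNumber, prod_mul_distrib]
  refine mul_le_mul_of_nonneg_right ?_
    (prod_nonneg fun p hp ↦ (inv_one_sub_inv_pos (mem_primesLE.1 hp).2).le)
  calc 1 - (N : ℝ)⁻¹ = 1 + N * (-(N : ℝ)⁻¹ ^ 2) := by field_simp; ring
    _ ≤ (1 + -(N : ℝ)⁻¹ ^ 2) ^ N := one_add_mul_le_pow (by linarith) N
    _ ≤ (1 - (N : ℝ)⁻¹ ^ 2) ^ #(primesLE N) := by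
        rw [← sub_eq_add_neg]
        exact pow_le_pow_of_le_one (by linarith) (by linarith [sq_nonneg (N : ℝ)⁻¹]) hcard
    _ = ∏ _p ∈ primesLE N, (1 - (N : ℝ)⁻¹ ^ 2) := (prod_const _).symm
    _ ≤ _ := prod_le_prod (fun _ _ ↦ by linarith) fun p hp ↦ by linarith [hpow p hp]

lemma log_extremalNumber_le {N : ℕ} (hN : N ≠ 0) :
    log (extremalNumber N) ≤ N * (8 * log N + 2) := by
  have hN1 : (1 : ℝ) ≤ N := mod_cast Nat.one_le_iff_ne_zero.2 hN
  have hl2 : 1 / 2 < log 2 := by linarith [log_two_gt_d9]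
  have hl2' : log 2 < 1 := by linarith [log_two_lt_d9]
  have hL : (Nat.log 2 N : ℝ) * log 2 ≤ log N := by
    rw [← log_pow]
    exact log_le_log (by positivity) (mod_cast Nat.pow_log_le_self 2 hN)
  have hP : log (primorial N) ≤ N * (2 * log 2) := by
    have h4 : log 4 = 2 * log 2 := by
      rw [show (4 : ℝ) = 2 ^ 2 by norm_num, log_pow]; norm_num
    rw [← h4, ← log_pow]
    exact log_le_log (mod_cast primorial_pos N) (mod_cast primorial_le_four_pow N)
  have hl := log_nonneg hN1
  rw [extremalNumber, Nat.cast_pow, log_pow]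
  push_cast
  calc (2 * (Nat.log 2 N : ℝ) + 1) * log (primorial N)
      ≤ (2 * (Nat.log 2 N : ℝ) + 1) * (N * (2 * log 2)) := by gcongr
    _ = N * (4 * (Nat.log 2 N * log 2) + 2 * log 2) := by ring
    _ ≤ N * (8 * log N + 2) := by gcongr <;> linarith

lemma le_sum_divisors_extremalNumber_div {N : ℕ} (hN : 3 ≤ N) :
    (∏ p ∈ primesLE N, (1 - (p : ℝ)⁻¹)⁻¹) / log N * (1 - (N : ℝ)⁻¹) *
        (1 + log (8 * log N + 2) / log N)⁻¹ ≤
      ((∑ d ∈ (extremalNumber N).divisors, d : ℕ) : ℝ) /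
        (extremalNumber N * log (log (extremalNumber N))) := by
  have hN3 : (3 : ℝ) ≤ N := mod_cast hN
  have hN0 : N ≠ 0 := by omega
  have hlN : 1 < log N := (lt_log_iff_exp_lt (by linarith)).2 (by linarith [exp_one_lt_d9])
  have hln : 1 < log (extremalNumber N) :=
    hlN.trans_le (log_le_log (by linarith) (mod_cast le_extremalNumber N))
  have hlln : 0 < log (log (extremalNumber N)) := log_pos hln
  have hub : log (log (extremalNumber N)) ≤ log N + log (8 * log N + 2) := by
    rw [← log_mul (by linarith) (by linarith)]
    exact log_le_log (by linarith) (log_extremalNumber_le hN0)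
  have h8 : 0 < log (8 * log N + 2) := log_pos (by linarith)
  rw [← div_div]
  calc _ = ((1 - (N : ℝ)⁻¹) * ∏ p ∈ primesLE N, (1 - (p : ℝ)⁻¹)⁻¹) /
        (log N + log (8 * log N + 2)) := by field_simp
    _ ≤ _ := by
      have h := one_sub_inv_mul_prod_le_sum_divisors_extremalNumber hN0
      gcongr

lemma tendsto_log_natCast_atTop : Tendsto (fun N : ℕ ↦ log N) atTop atTop :=
  tendsto_log_atTop.comp tendsto_natCast_atTop_atTop

lemma tendsto_log_eight_mul_add_two_div :
    Tendsto (fun x : ℝ ↦ log (8 * x + 2) / x) atTop (𝓝 0) := by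
  have hy : Tendsto (fun x : ℝ ↦ 8 * x + 2) atTop atTop :=
    tendsto_atTop_add_const_right _ _ (tendsto_id.const_mul_atTop (by norm_num))
  have h1 := isLittleO_log_id_atTop.tendsto_div_nhds_zero.comp hy
  have h2 : Tendsto (fun x : ℝ ↦ 8 + 2 / x) atTop (𝓝 (8 + 0)) :=
    (tendsto_const_nhds.div_atTop tendsto_id).const_add 8
  have h := h1.mul h2
  rw [zero_mul] at h
  refine h.congr' ?_
  filter_upwards [eventually_gt_atTop 0] with x hx
  simp only [Function.comp_apply, id]
  field_simp

lemma tendsto_lower_bound :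
    Tendsto (fun N : ℕ ↦ (∏ p ∈ primesLE N, (1 - (p : ℝ)⁻¹)⁻¹) / log N * (1 - (N : ℝ)⁻¹) *
      (1 + log (8 * log N + 2) / log N)⁻¹) atTop (𝓝 (exp eulerMascheroniConstant)) := by
  have h1 : Tendsto (fun N : ℕ ↦ 1 - (N : ℝ)⁻¹) atTop (𝓝 (1 - 0)) :=
    (tendsto_inv_atTop_zero.comp tendsto_natCast_atTop_atTop).const_sub 1
  have h2 := ((tendsto_log_eight_mul_add_two_div.comp tendsto_log_natCast_atTop).const_add 1).inv₀
    (by norm_num)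
  simpa using (tendsto_prod_inv_one_sub_inv_div_log.mul h1).mul h2

lemma tendsto_upper_bound :
    Tendsto (fun m : ℕ ↦ (∏ p ∈ primesLE m, (1 - (p : ℝ)⁻¹)⁻¹) / log m * exp (2 / log m)) atTop
      (𝓝 (exp eulerMascheroniConstant)) := by
  have h : Tendsto (fun m : ℕ ↦ exp (2 / log m)) atTop (𝓝 (exp 0)) :=
    (continuous_exp.tendsto 0).comp (tendsto_const_nhds.div_atTop tendsto_log_natCast_atTop)
  simpa using tendsto_prod_inv_one_sub_inv_div_log.mul h

end Mertens

open Mertens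

/-- **Gronwall's theorem.** `limsup σ(n)/(n log log n) = e^γ`. -/
theorem limsup_sigma_div_eq_exp_gamma :
    Filter.limsup
      (fun n : ℕ => ((∑ d ∈ n.divisors, d : ℕ) : ℝ) / (n * Real.log (Real.log n)))
      Filter.atTop = Real.exp Real.eulerMascheroniConstant := by
  set u : ℕ → ℝ := fun n ↦ ((∑ d ∈ n.divisors, d : ℕ) : ℝ) / (n * Real.log (Real.log n))
  have hfloor : Tendsto (fun n : ℕ ↦ ⌊log n⌋₊) atTop atTop :=
    tendsto_nat_floor_atTop.comp tendsto_log_natCast_atTop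
  have hupper : ∀ a, exp eulerMascheroniConstant < a → ∀ᶠ n in atTop, u n ≤ a := fun a ha ↦ by
    filter_upwards [(tendsto_upper_bound.comp hfloor).eventually_lt_const ha,
      hfloor.eventually_ge_atTop 2, eventually_ne_atTop 0] with n h1 h2 h3
    exact (sum_divisors_div_le h3 h2).trans h1.le
  have hlower : ∀ a, a < exp eulerMascheroniConstant → ∃ᶠ n in atTop, a ≤ u n := fun a ha ↦ by
    have hlim : Tendsto extremalNumber atTop atTop :=
      tendsto_atTop_mono le_extremalNumber tendsto_id
    refine hlim.frequently (Eventually.frequently ?_)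
    filter_upwards [tendsto_lower_bound.eventually_const_lt ha, eventually_ge_atTop 3] with N h1 h2
    exact h1.le.trans (le_sum_divisors_extremalNumber_div h2)
  have hbdd : IsBoundedUnder (· ≤ ·) atTop u :=
    isBoundedUnder_of_eventually_le (hupper _ (lt_add_one _))
  refine le_antisymm (le_of_forall_gt_imp_ge_of_dense fun a ha ↦ ?_)
    (le_of_forall_lt_imp_le_of_dense fun a ha ↦ le_limsup_of_frequently_le (hlower a ha) hbdd)
  exact limsup_le_of_le (IsCoboundedUnder.of_frequently_ge (hlower _ (sub_one_lt _))) (hupper a ha)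
end

section
/- liminf_{n→∞} φ(n)·log log n / n = e^{-γ}, where φ is Euler's totient function and γ is Euler's constant. -/
open Filter Real

/-- `log (n!) = ∑_{p ≤ n} v_p(n!) log p`. -/
theorem log_factorial_eq_sum_primesLE (n : ℕ) :
    Real.log (n.factorial : ℝ) =
      ∑ p ∈ Nat.primesLE n, (n.factorial.factorization p : ℝ) * Real.log p := by
  rw [Real.log_nat_eq_sum_factorization, Finsupp.sum]
  refine Finset.sum_subset (fun p hp => ?_) (fun p _ hp => ?_)
  · have hp' : p.Prime ∧ p ∣ n.factorial ∧ n.factorial ≠ 0 := by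
      simpa using hp
    rw [Nat.mem_primesLE]
    exact ⟨(hp'.1.dvd_factorial).1 hp'.2.1, hp'.1⟩
  · rw [Finsupp.notMem_support_iff.1 hp]
    simp

theorem log_factorial_le (n : ℕ) : Real.log (n.factorial : ℝ) ≤ n * Real.log n := by
  rw [← Real.log_pow]
  exact Real.log_le_log (by exact_mod_cast n.factorial_pos) (by exact_mod_cast n.factorial_le_pow)

theorem sub_le_log_factorial (n : ℕ) (hn : n ≠ 0) :
    n * Real.log n - n ≤ Real.log (n.factorial : ℝ) := by
  have h := Stirling.le_log_factorial_stirling hn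
  have h1 : 0 ≤ Real.log n := Real.log_natCast_nonneg n
  have h2 : 0 ≤ Real.log (2 * π) := Real.log_nonneg (by nlinarith [Real.pi_gt_three])
  linarith

theorem sub_one_le_factorization_factorial {n p : ℕ} (hp : p.Prime) :
    (n : ℝ) / p - 1 ≤ (n.factorial.factorization p : ℝ) := by
  have h : n / p ≤ n.factorial.factorization p := by
    have h1 := Nat.factorization_factorial_mul (n := n / p) hp
    have h2 : (p * (n / p)).factorial.factorization p ≤ n.factorial.factorization p :=
      (Nat.factorization_le_iff_dvd (Nat.factorial_ne_zero _) (Nat.factorial_ne_zero _)).2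
        (Nat.factorial_dvd_factorial (Nat.mul_div_le n p)) p
    omega
  have h3 : (n : ℝ) / p < (n / p : ℕ) + 1 := by
    rw [div_lt_iff₀ (by exact_mod_cast hp.pos)]
    have h5 := Nat.lt_mul_div_succ n hp.pos
    rw [mul_comm] at h5
    exact_mod_cast h5
  have h4 : ((n / p : ℕ) : ℝ) ≤ (n.factorial.factorization p : ℝ) := by exact_mod_cast h
  linarith

theorem factorization_factorial_le {n p : ℕ} (hp : p.Prime) :
    (n.factorial.factorization p : ℝ) ≤ (n : ℝ) / (p - 1) := by
  have h2 : (2 : ℝ) ≤ p := by exact_mod_cast hp.two_le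
  rw [le_div_iff₀ (by linarith)]
  have h := Nat.sub_one_mul_factorization_factorial (n := n) hp
  have h' : (p - 1) * n.factorial.factorization p ≤ n := by omega
  have h3 : ((p - 1 : ℕ) : ℝ) * (n.factorial.factorization p : ℝ) ≤ n := by exact_mod_cast h'
  rw [Nat.cast_sub hp.one_le] at h3
  push_cast at h3
  linarith

theorem summable_log_div_mul_sub_one :
    Summable fun n : ℕ => Real.log n / (n * (n - 1 : ℝ)) := by
  have h : Summable fun n : ℕ => 4 * (1 / (n : ℝ) ^ (3 / 2 : ℝ)) :=
    (Real.summable_one_div_nat_rpow.2 (by norm_num)).mul_left 4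
  refine Summable.of_norm_bounded_eventually_nat h ?_
  filter_upwards [eventually_ge_atTop 2] with n hn
  have h2 : (2 : ℝ) ≤ n := by exact_mod_cast hn
  have hl : Real.log n ≤ (n : ℝ) ^ (1 / 2 : ℝ) / (1 / 2) :=
    Real.log_le_rpow_div (by positivity) (by norm_num)
  have hl0 : 0 ≤ Real.log n := Real.log_natCast_nonneg n
  rw [Real.norm_of_nonneg (div_nonneg hl0 (mul_nonneg (by linarith) (by linarith))),
    div_le_iff₀ (mul_pos (by linarith) (by linarith))]
  have e : (n : ℝ) ^ 2 = (n : ℝ) ^ (3 / 2 : ℝ) * (n : ℝ) ^ (1 / 2 : ℝ) := by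
    rw [← Real.rpow_add (by linarith)]; norm_num
  have hpos : 0 < (n : ℝ) ^ (3 / 2 : ℝ) := Real.rpow_pos_of_pos (by linarith) _
  have : 4 * (1 / (n : ℝ) ^ (3 / 2 : ℝ)) * (n * (n - 1 : ℝ)) ≥
      4 * (1 / (n : ℝ) ^ (3 / 2 : ℝ)) * ((n : ℝ) ^ 2 / 2) := by
    gcongr
    nlinarith
  rw [e] at this
  field_simp at this hl ⊢
  linarith [mul_le_mul_of_nonneg_left hl hpos.le]

/-- **Mertens' first theorem**: `∑_{p ≤ n} log p / p = log n + O(1)`. -/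
theorem exists_abs_sum_log_div_sub_log_le :
    ∃ C : ℝ, ∀ n : ℕ, n ≠ 0 →
      |∑ p ∈ Nat.primesLE n, Real.log p / p - Real.log n| ≤ C := by
  set K := ∑' n : ℕ, Real.log n / (n * (n - 1 : ℝ)) with hK
  refine ⟨1 + K + Real.log 4, fun n hn => ?_⟩
  have hterm : ∀ m : ℕ, 0 ≤ Real.log m / (m * (m - 1 : ℝ)) := fun m => by
    rcases m.eq_zero_or_pos with rfl | hm
    · simp
    · have : (1 : ℝ) ≤ m := by exact_mod_cast hm
      exact div_nonneg (Real.log_natCast_nonneg m) (mul_nonneg (by linarith) (by linarith))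
  have hK0 : 0 ≤ K := tsum_nonneg hterm
  have hl4 : 0 ≤ Real.log 4 := Real.log_nonneg (by norm_num)
  have hn0 : (0 : ℝ) < n := by exact_mod_cast Nat.pos_of_ne_zero hn
  have hf := log_factorial_eq_sum_primesLE n
  rw [abs_le]
  constructor
  · have h1 : Real.log (n.factorial : ℝ) ≤
        n * (∑ p ∈ Nat.primesLE n, Real.log p / p + K) := by
      calc Real.log (n.factorial : ℝ)
          ≤ ∑ p ∈ Nat.primesLE n,
              n * (Real.log p / p + Real.log p / (p * (p - 1 : ℝ))) := by
            rw [hf]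
            refine Finset.sum_le_sum fun p hp => ?_
            have hp' := Nat.prime_of_mem_primesLE hp
            have h2 : (2 : ℝ) ≤ p := by exact_mod_cast hp'.two_le
            calc _ ≤ (n : ℝ) / (p - 1) * Real.log p :=
                  mul_le_mul_of_nonneg_right (factorization_factorial_le hp')
                    (Real.log_natCast_nonneg p)
              _ = _ := by
                  have : (p : ℝ) - 1 ≠ 0 := by linarith
                  field_simp
                  ring
        _ = n * (∑ p ∈ Nat.primesLE n, Real.log p / p +
              ∑ p ∈ Nat.primesLE n, Real.log p / (p * (p - 1 : ℝ))) := by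
            rw [← Finset.mul_sum, Finset.sum_add_distrib]
        _ ≤ _ := by
            gcongr
            exact summable_log_div_mul_sub_one.sum_le_tsum _ fun m _ => hterm m
    have h2 := (sub_le_log_factorial n hn).trans h1
    have h3 : Real.log n - 1 ≤ ∑ p ∈ Nat.primesLE n, Real.log p / p + K :=
      le_of_mul_le_mul_left (by linarith) hn0
    linarith
  · have h1 : n * ∑ p ∈ Nat.primesLE n, Real.log p / p - Chebyshev.theta n ≤
        Real.log (n.factorial : ℝ) := by
      rw [hf, Chebyshev.theta_eq_sum_primesLE_log, Finset.mul_sum, ← Finset.sum_sub_distrib]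
      refine Finset.sum_le_sum fun p hp => ?_
      calc _ = ((n : ℝ) / p - 1) * Real.log p := by ring
        _ ≤ _ := mul_le_mul_of_nonneg_right
            (sub_one_le_factorization_factorial (Nat.prime_of_mem_primesLE hp))
            (Real.log_natCast_nonneg p)
    have h2 := Chebyshev.theta_le_log4_mul_x hn0.le
    have h3 := log_factorial_le n
    have h4 : ∑ p ∈ Nat.primesLE n, Real.log p / p ≤ Real.log n + Real.log 4 :=
      le_of_mul_le_mul_left (by linarith) hn0
    linarith

theorem sum_primesLE_add_one (f : ℕ → ℝ) (n : ℕ) :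
    ∑ p ∈ Nat.primesLE (n + 1), f p =
      ∑ i ∈ Finset.range n, if (i + 2).Prime then f (i + 2) else 0 := by
  rw [Nat.primesLE_eq_filter_range, Finset.sum_filter, Finset.sum_range_succ', Finset.sum_range_succ']
  simp [Nat.not_prime_zero, Nat.not_prime_one]

/-- The increments of `log log` are approximated by those of `log` divided by `log`. -/
theorem exists_tendsto_sum_log_sub_log_div_log_sub_log_log :
    ∃ C : ℝ, Tendsto (fun n : ℕ => ∑ i ∈ Finset.range n,
        (Real.log (i + 2) - Real.log (i + 1)) / Real.log (i + 2) - Real.log (Real.log (n + 1)))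
      atTop (nhds C) := by
  set t : ℕ → ℝ := fun i => Real.log (Real.log (i + 3)) - Real.log (Real.log (i + 2)) -
    (Real.log (i + 3) - Real.log (i + 2)) / Real.log (i + 3) with ht
  have key : ∀ i : ℕ, 0 ≤ t i ∧
      t i ≤ 1 / Real.log (i + 2) - 1 / Real.log ((i + 1 : ℕ) + 2) := fun i => by
    have e : ((i + 1 : ℕ) : ℝ) + 2 = i + 3 := by push_cast; ring
    rw [e]
    have hi : (0 : ℝ) ≤ i := i.cast_nonneg
    have ha : 0 < Real.log ((i : ℝ) + 2) := Real.log_pos (by linarith)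
    have hb : 0 < Real.log ((i : ℝ) + 3) := Real.log_pos (by linarith)
    have hab : Real.log ((i : ℝ) + 2) ≤ Real.log (i + 3) :=
      Real.log_le_log (by linarith) (by linarith)
    have hd : Real.log ((i : ℝ) + 3) - Real.log (i + 2) ≤ 1 := by
      rw [← Real.log_div (by linarith) (by linarith)]
      refine (Real.log_le_sub_one_of_pos (by positivity)).trans ?_
      rw [sub_le_iff_le_add, div_le_iff₀ (by linarith)]
      linarith
    simp only [ht]
    generalize Real.log ((i : ℝ) + 2) = a at *
    generalize Real.log ((i : ℝ) + 3) = b at *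
    rw [← Real.log_div hb.ne' ha.ne']
    have h1 := Real.one_sub_inv_le_log_of_pos (div_pos hb ha)
    have h2 := Real.log_le_sub_one_of_pos (div_pos hb ha)
    constructor
    · have : 1 - (b / a)⁻¹ = (b - a) / b := by field_simp
      linarith
    · have h3 : b / a - 1 - (b - a) / b = (b - a) * (1 / a - 1 / b) := by field_simp
      have h4 : (b - a) * (1 / a - 1 / b) ≤ 1 * (1 / a - 1 / b) := by
        refine mul_le_mul_of_nonneg_right hd ?_
        rw [sub_nonneg]
        exact one_div_le_one_div_of_le ha hab
      linarith
  have hsum : Summable t := by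
    refine summable_of_sum_range_le (c := 1 / Real.log 2) (fun i => (key i).1) fun n => ?_
    refine (Finset.sum_le_sum fun i _ => (key i).2).trans ?_
    rw [Finset.sum_range_sub' (fun i : ℕ => 1 / Real.log ((i : ℝ) + 2))]
    have : 0 ≤ 1 / Real.log ((n : ℝ) + 2) :=
      one_div_nonneg.2 (Real.log_nonneg (by linarith [n.cast_nonneg (α := ℝ)]))
    simpa using this
  refine ⟨1 - Real.log (Real.log 2) - ∑' i, t i, ?_⟩
  rw [← tendsto_add_atTop_iff_nat 1]
  refine (hsum.hasSum.tendsto_sum_nat.const_sub _).congr fun n => ?_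
  rw [Finset.sum_range_succ']
  have h2 : Real.log 2 ≠ 0 := (Real.log_pos one_lt_two).ne'
  have h3 := Finset.sum_range_sub (fun i : ℕ => Real.log (Real.log ((i : ℝ) + 2))) n
  have h4 : ∑ i ∈ Finset.range n, t i = Real.log (Real.log (n + 2)) - Real.log (Real.log 2) -
      ∑ i ∈ Finset.range n, (Real.log (i + 3) - Real.log (i + 2)) / Real.log (i + 3) := by
    rw [ht, Finset.sum_sub_distrib]
    congr 1
    rw [Nat.cast_zero, zero_add] at h3
    rw [← h3]
    refine Finset.sum_congr rfl fun i _ => ?_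
    push_cast
    ring_nf
  rw [h4]
  have h5 : ∀ i : ℕ, ((i + 1 : ℕ) : ℝ) + 2 = i + 3 := fun i => by push_cast; ring
  have h6 : ∀ i : ℕ, ((i + 1 : ℕ) : ℝ) + 1 = i + 2 := fun i => by push_cast; ring
  simp only [h5, h6]
  simp [h2]
  ring

/-- **Mertens' second theorem**: `∑_{p ≤ n} 1 / p - log log n` converges. -/
theorem exists_tendsto_sum_one_div_sub_log_log :
    ∃ C : ℝ, Tendsto (fun n : ℕ => ∑ p ∈ Nat.primesLE n, 1 / (p : ℝ) - Real.log (Real.log n))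
      atTop (nhds C) := by
  obtain ⟨K, hK⟩ := exists_abs_sum_log_div_sub_log_le
  obtain ⟨C₁, h₁⟩ := exists_tendsto_sum_log_sub_log_div_log_sub_log_log
  set f : ℕ → ℝ := fun i => 1 / Real.log (i + 2)
  set z : ℕ → ℝ := fun i => (if (i + 2).Prime then Real.log (i + 2 : ℕ) / (i + 2 : ℕ) else 0) -
    (Real.log (i + 2) - Real.log (i + 1)) with hz
  have hf : Antitone f := fun i j hij => by
    have h : (i : ℝ) ≤ j := by exact_mod_cast hij
    have hi : (0 : ℝ) ≤ i := i.cast_nonneg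
    exact one_div_le_one_div_of_le (Real.log_pos (by linarith))
      (Real.log_le_log (by linarith) (by linarith))
  have hf0 : Tendsto f atTop (nhds 0) := by
    have : Tendsto (fun i : ℕ => Real.log ((i : ℝ) + 2)) atTop atTop :=
      Real.tendsto_log_atTop.comp
        (tendsto_atTop_add_const_right _ _ tendsto_natCast_atTop_atTop)
    exact this.inv_tendsto_atTop.congr fun i => by simp [f]
  have hzb : ∀ n, ‖∑ i ∈ Finset.range n, z i‖ ≤ K := fun n => by
    have h := hK (n + 1) n.succ_ne_zero
    rw [sum_primesLE_add_one (fun p => Real.log p / p)] at h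
    rw [hz, Finset.sum_sub_distrib, Real.norm_eq_abs]
    convert h using 3
    have h3 := Finset.sum_range_sub (fun i : ℕ => Real.log ((i : ℝ) + 1)) n
    simp only [Nat.cast_zero, zero_add, Real.log_one, sub_zero] at h3
    push_cast at h3 ⊢
    rw [← h3]
    refine Finset.sum_congr rfl fun i _ => ?_
    ring_nf
  obtain ⟨C₂, h₂⟩ := cauchySeq_tendsto_of_complete
    (hf.cauchySeq_series_mul_of_tendsto_zero_of_bounded hf0 hzb)
  refine ⟨C₂ + C₁, ?_⟩
  rw [← tendsto_add_atTop_iff_nat 1]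
  refine (h₂.add h₁).congr fun n => ?_
  rw [sum_primesLE_add_one (fun p => 1 / (p : ℝ)), ← add_sub_assoc, ← Finset.sum_add_distrib]
  push_cast
  congr 1
  refine Finset.sum_congr rfl fun i _ => ?_
  have hl : Real.log ((i : ℝ) + 2) ≠ 0 :=
    (Real.log_pos (by linarith [i.cast_nonneg (α := ℝ)])).ne'
  simp only [f, hz, smul_eq_mul]
  split_ifs
  · push_cast
    field_simp
    ring
  · field_simp
    ring

theorem log_re_riemannZeta_eq_tsum_primes {s : ℝ} (hs : 1 < s) :
    Real.log (riemannZeta s).re = ∑' p : Nat.Primes, -Real.log (1 - (p : ℝ) ^ (-s)) := by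
  rw [← riemannZeta_eulerProduct_exp_log (s := (s : ℂ)) (by simpa using hs)]
  have h : ∀ p : Nat.Primes, -Complex.log (1 - (p : ℂ) ^ (-(s : ℂ))) =
      ((-Real.log (1 - (p : ℝ) ^ (-s)) : ℝ) : ℂ) := fun p => by
    have hp : (1 : ℝ) ≤ (p : ℕ) := by exact_mod_cast p.prop.one_le
    have h1 : ((p : ℕ) : ℝ) ^ (-s) ≤ 1 := Real.rpow_le_one_of_one_le_of_nonpos hp (by linarith)
    rw [Complex.ofReal_neg, Complex.ofReal_log (by linarith)]
    push_cast [Complex.ofReal_cpow (by positivity : (0 : ℝ) ≤ (p : ℕ))]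
    rfl
  simp_rw [h]
  rw [← Complex.ofReal_tsum, Complex.exp_ofReal_re, Real.log_exp]

theorem neg_log_one_sub_sub_nonneg {x : ℝ} (hx : x < 1) : 0 ≤ -Real.log (1 - x) - x := by
  have := Real.log_le_sub_one_of_pos (sub_pos.2 hx)
  linarith

theorem neg_log_one_sub_sub_le {x : ℝ} (hx : x ≤ 1 / 2) :
    -Real.log (1 - x) - x ≤ 2 * x ^ 2 := by
  have h := Real.one_sub_inv_le_log_of_pos (show 0 < 1 - x by linarith)
  have h2 : (1 - x)⁻¹ ≤ 1 + x + 2 * x ^ 2 := by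
    rw [inv_le_iff_one_le_mul₀ (by linarith)]
    nlinarith [mul_nonneg (sq_nonneg x) (show 0 ≤ 1 - 2 * x by linarith)]
  linarith

theorem rpow_neg_primes_le_half (p : Nat.Primes) {s : ℝ} (hs : 1 ≤ s) :
    (p : ℝ) ^ (-s) ≤ 1 / 2 := by
  have hp : (2 : ℝ) ≤ (p : ℕ) := by exact_mod_cast p.prop.two_le
  calc ((p : ℕ) : ℝ) ^ (-s) ≤ ((p : ℕ) : ℝ) ^ (-1 : ℝ) :=
        Real.rpow_le_rpow_of_exponent_le (by linarith) (by linarith)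
    _ = 1 / (p : ℕ) := by rw [Real.rpow_neg_one, one_div]
    _ ≤ 1 / 2 := one_div_le_one_div_of_le two_pos hp

theorem norm_neg_log_one_sub_sub_primes_le (p : Nat.Primes) {s : ℝ} (hs : 1 ≤ s) :
    ‖-Real.log (1 - (p : ℝ) ^ (-s)) - (p : ℝ) ^ (-s)‖ ≤ 2 * (p : ℝ) ^ (-2 : ℝ) := by
  have hp : (1 : ℝ) ≤ (p : ℕ) := by exact_mod_cast p.prop.one_le
  have h := rpow_neg_primes_le_half p hs
  rw [Real.norm_of_nonneg (neg_log_one_sub_sub_nonneg (by linarith))]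
  refine (neg_log_one_sub_sub_le h).trans ?_
  rw [← Real.rpow_mul_natCast (by linarith)]
  gcongr
  push_cast
  linarith

theorem summable_two_mul_primes_rpow_neg_two :
    Summable fun p : Nat.Primes => 2 * (p : ℝ) ^ (-2 : ℝ) :=
  (Nat.Primes.summable_rpow.2 (by norm_num)).mul_left 2

theorem summable_neg_log_one_sub_sub_primes {s : ℝ} (hs : 1 ≤ s) :
    Summable fun p : Nat.Primes => -Real.log (1 - (p : ℝ) ^ (-s)) - (p : ℝ) ^ (-s) :=
  summable_two_mul_primes_rpow_neg_two.of_norm_bounded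
    fun p => norm_neg_log_one_sub_sub_primes_le p hs

/-- The prime zeta function satisfies
`P(1 + δ) = -log δ - ∑_p (-log (1 - 1 / p) - 1 / p) + o(1)` as `δ → 0⁺`. -/
theorem tendsto_tsum_primes_rpow_add_log :
    Tendsto (fun δ : ℝ => ∑' p : Nat.Primes, (p : ℝ) ^ (-(1 + δ)) + Real.log δ)
      (nhdsWithin 0 (Set.Ioi 0))
      (nhds (-∑' p : Nat.Primes, (-Real.log (1 - (p : ℝ) ^ (-1 : ℝ)) - (p : ℝ) ^ (-1 : ℝ)))) := by
  have hδ : Tendsto (fun δ : ℝ => 1 + δ) (nhdsWithin 0 (Set.Ioi 0))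
      (nhdsWithin 1 (Set.Ioi 1)) := by
    refine tendsto_nhdsWithin_iff.2 ⟨?_, ?_⟩
    · refine Tendsto.mono_left ?_ nhdsWithin_le_nhds
      exact (Continuous.tendsto' (by fun_prop) _ _ (by simp))
    · filter_upwards [self_mem_nhdsWithin] with δ hδ
      simpa using hδ
  have hz := (Asymptotics.isLittleO_one_iff ℝ).1
    (log_riemannZeta_add_log_sub_isLittleO_ofReal.comp_tendsto hδ)
  have hr : Tendsto (fun δ : ℝ => ∑' p : Nat.Primes,
      (-Real.log (1 - (p : ℝ) ^ (-(1 + δ))) - (p : ℝ) ^ (-(1 + δ))))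
      (nhdsWithin 0 (Set.Ioi 0))
      (nhds (∑' p : Nat.Primes,
        (-Real.log (1 - (p : ℝ) ^ (-1 : ℝ)) - (p : ℝ) ^ (-1 : ℝ)))) := by
    refine tendsto_tsum_of_dominated_convergence summable_two_mul_primes_rpow_neg_two
      (fun p => ?_) ?_
    · have hp : (0 : ℝ) < (p : ℕ) := by exact_mod_cast p.prop.pos
      have h1 := rpow_neg_primes_le_half p le_rfl
      have hc : Tendsto (fun δ : ℝ => ((p : ℕ) : ℝ) ^ (-(1 + δ))) (nhdsWithin 0 (Set.Ioi 0))
          (nhds (((p : ℕ) : ℝ) ^ (-1 : ℝ))) := by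
        refine tendsto_const_nhds.rpow ?_ (Or.inl hp.ne')
        exact (hδ.mono_right nhdsWithin_le_nhds).neg
      exact (((hc.const_sub 1).log (by linarith)).neg).sub hc
    · filter_upwards [self_mem_nhdsWithin] with δ hδ p
      exact norm_neg_log_one_sub_sub_primes_le p (by linarith [Set.mem_Ioi.1 hδ])
  have := hz.sub hr
  rw [zero_sub] at this
  refine this.congr' ?_
  filter_upwards [self_mem_nhdsWithin] with δ hδ
  have hδ' : 0 < δ := hδ
  have h1 : Summable fun p : Nat.Primes => (p : ℝ) ^ (-(1 + δ)) :=
    Nat.Primes.summable_rpow.2 (by linarith)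
  have h2 := summable_neg_log_one_sub_sub_primes (s := 1 + δ) (by linarith)
  have h3 := log_re_riemannZeta_eq_tsum_primes (s := 1 + δ) (by linarith)
  have h4 := h2.tsum_add h1
  simp only [sub_add_cancel] at h4
  simp only [Function.comp_apply, add_sub_cancel_left, h3, h4]
  ring

/-- An Abelian theorem: a bounded function with a limit at infinity has the same limit on average
against `exp (-t)`. -/
theorem tendsto_integral_exp_neg_mul_comp_div {A : ℝ → ℝ} (hA : Measurable A) {M c : ℝ}
    (hM : ∀ u, 0 < u → |A u| ≤ M) (hc : Tendsto A atTop (nhds c)) :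
    Tendsto (fun δ : ℝ => ∫ t in Set.Ioi 0, Real.exp (-t) * A (t / δ))
      (nhdsWithin 0 (Set.Ioi 0)) (nhds c) := by
  have hint : MeasureTheory.IntegrableOn (fun t : ℝ => Real.exp (-t)) (Set.Ioi 0) :=
    integrableOn_exp_neg_Ioi 0
  have h : Tendsto (fun δ : ℝ => ∫ t in Set.Ioi 0, Real.exp (-t) * A (t / δ))
      (nhdsWithin 0 (Set.Ioi 0)) (nhds (∫ t in Set.Ioi 0, Real.exp (-t) * c)) := by
    refine MeasureTheory.tendsto_integral_filter_of_dominated_convergence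
      (fun t => Real.exp (-t) * M) (Eventually.of_forall fun δ => ?_) ?_ (hint.mul_const M) ?_
    · exact Measurable.aestronglyMeasurable (by fun_prop)
    · filter_upwards [self_mem_nhdsWithin] with δ hδ
      filter_upwards [MeasureTheory.ae_restrict_mem measurableSet_Ioi] with t ht
      rw [norm_mul, Real.norm_of_nonneg (Real.exp_pos _).le]
      exact mul_le_mul_of_nonneg_left (hM _ (div_pos ht hδ)) (Real.exp_pos _).le
    · filter_upwards [MeasureTheory.ae_restrict_mem measurableSet_Ioi] with t ht
      refine (hc.comp ?_).const_mul _
      exact tendsto_inv_nhdsGT_zero.const_mul_atTop ht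
  rwa [MeasureTheory.integral_mul_const, integral_exp_neg_Ioi_zero, one_mul] at h

theorem integral_exp_neg_mul_ite {δ l : ℝ} (hδ : 0 < δ) (hl : 0 ≤ l) (c : ℝ) :
    ∫ t in Set.Ioi (0 : ℝ), Real.exp (-t) * (if l ≤ t / δ then c else 0) =
      c * Real.exp (-(δ * l)) := by
  have e : (fun t : ℝ => Real.exp (-t) * (if l ≤ t / δ then c else 0)) =
      (Set.Ici (δ * l)).indicator fun t => Real.exp (-t) * c := by
    ext t
    have : l ≤ t / δ ↔ δ * l ≤ t := by rw [le_div_iff₀ hδ, mul_comm]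
    simp [Set.indicator_apply, this]
  rw [e, ← MeasureTheory.integral_Ici_eq_integral_Ioi,
    MeasureTheory.setIntegral_indicator measurableSet_Ici, Set.Ici_inter_Ici,
    sup_of_le_right (by positivity), MeasureTheory.integral_Ici_eq_integral_Ioi,
    MeasureTheory.integral_mul_const, integral_exp_neg_Ioi, mul_comm]

theorem integrableOn_exp_neg_mul_ite {δ : ℝ} (l c : ℝ) :
    MeasureTheory.IntegrableOn
      (fun t : ℝ => Real.exp (-t) * (if l ≤ t / δ then c else 0)) (Set.Ioi 0) := by
  have hint : MeasureTheory.IntegrableOn (fun t : ℝ => Real.exp (-t)) (Set.Ioi 0) :=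
    integrableOn_exp_neg_Ioi 0
  refine MeasureTheory.Integrable.mono' (hint.mul_const |c|) ?_ (Eventually.of_forall fun t => ?_)
  · refine Measurable.aestronglyMeasurable ((by fun_prop : Measurable _).mul ?_)
    exact Measurable.ite (measurableSet_le (by fun_prop) (by fun_prop)) (by fun_prop)
      (by fun_prop)
  · rw [norm_mul, Real.norm_of_nonneg (Real.exp_pos _).le]
    refine mul_le_mul_of_nonneg_left ?_ (Real.exp_pos _).le
    split_ifs
    · exact le_rfl
    · simp

/-- A general Dirichlet series as the Laplace transform of its summatory function. -/
theorem hasSum_mul_exp_integral {ι : Type*} [Countable ι] {c l : ι → ℝ} (hl : ∀ i, 0 ≤ l i)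
    {δ : ℝ} (hδ : 0 < δ) (hs : Summable fun i => |c i| * Real.exp (-(δ * l i))) :
    HasSum (fun i => c i * Real.exp (-(δ * l i)))
      (∫ t in Set.Ioi (0 : ℝ), Real.exp (-t) * ∑' i, if l i ≤ t / δ then c i else 0) := by
  simp_rw [← tsum_mul_left]
  simp_rw [← fun i => integral_exp_neg_mul_ite hδ (hl i) (c i)]
  refine MeasureTheory.hasSum_integral_of_summable_integral_norm
    (fun i => integrableOn_exp_neg_mul_ite (l i) (c i)) ?_
  refine hs.congr fun i => ?_
  rw [← integral_exp_neg_mul_ite hδ (hl i)]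
  congr 1
  ext t
  rw [norm_mul, Real.norm_of_nonneg (Real.exp_pos _).le]
  split_ifs <;> simp

theorem hasSum_primes_ite_log_le (u : ℝ) :
    HasSum (fun p : Nat.Primes => if Real.log (p : ℕ) ≤ u then 1 / ((p : ℕ) : ℝ) else 0)
      (∑ p ∈ Nat.primesLE ⌊Real.exp u⌋₊, 1 / (p : ℝ)) := by
  set f : ℕ → ℝ := fun p => if Real.log p ≤ u then 1 / (p : ℝ) else 0
  refine (hasSum_subtype_iff_indicator (f := f) (s := {p : ℕ | p.Prime})).2 ?_
  have hmem : ∀ p : ℕ, p.Prime → (p ∈ Nat.primesLE ⌊Real.exp u⌋₊ ↔ Real.log p ≤ u) := by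
    intro p hp
    have hp0 : (0 : ℝ) < p := by exact_mod_cast hp.pos
    rw [Nat.mem_primesLE, Nat.le_floor_iff (Real.exp_pos u).le, Real.log_le_iff_le_exp hp0]
    simp [hp]
  have e : ∑ p ∈ Nat.primesLE ⌊Real.exp u⌋₊, 1 / (p : ℝ) =
      ∑ p ∈ Nat.primesLE ⌊Real.exp u⌋₊, {p : ℕ | p.Prime}.indicator f p :=
    Finset.sum_congr rfl fun p hp => by
      have hp' := Nat.prime_of_mem_primesLE hp
      rw [Set.indicator_of_mem (show p ∈ {p : ℕ | p.Prime} from hp')]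
      exact (if_pos ((hmem p hp').1 hp)).symm
  rw [e]
  refine hasSum_sum_of_ne_finset_zero fun p hp => ?_
  by_cases hp' : p.Prime
  · rw [Set.indicator_of_mem (show p ∈ {p : ℕ | p.Prime} from hp')]
    exact if_neg (mt (hmem p hp').2 hp)
  · exact Set.indicator_of_notMem hp' _

theorem hasSum_ite_add_one_le {u : ℝ} (hu : 0 ≤ u) :
    HasSum (fun n : ℕ => if (n : ℝ) + 1 ≤ u then -(1 / ((n : ℝ) + 1)) else 0)
      (-(harmonic ⌊u⌋₊ : ℝ)) := by
  have hmem : ∀ n : ℕ, n ∈ Finset.range ⌊u⌋₊ ↔ (n : ℝ) + 1 ≤ u := fun n => by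
    rw [Finset.mem_range, ← Nat.succ_le_iff, Nat.le_floor_iff hu]
    push_cast
    rfl
  have e : -(harmonic ⌊u⌋₊ : ℝ) = ∑ n ∈ Finset.range ⌊u⌋₊,
      if (n : ℝ) + 1 ≤ u then -(1 / ((n : ℝ) + 1)) else 0 := by
    rw [harmonic]
    push_cast
    rw [← Finset.sum_neg_distrib]
    refine Finset.sum_congr rfl fun n hn => ?_
    rw [if_pos ((hmem n).1 hn), one_div]
  rw [e]
  exact hasSum_sum_of_ne_finset_zero fun n hn => if_neg (mt (hmem n).2 hn)

theorem tendsto_log_one_sub_exp_neg_sub_log :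
    Tendsto (fun δ : ℝ => Real.log (1 - Real.exp (-δ)) - Real.log δ)
      (nhdsWithin 0 (Set.Ioi 0)) (nhds 0) := by
  have hd : HasDerivAt (fun δ : ℝ => 1 - Real.exp (-δ)) 1 0 := by
    simpa using ((hasDerivAt_neg (0 : ℝ)).exp).const_sub 1
  have h := (hasDerivAt_iff_tendsto_slope.1 hd).mono_left
    (nhdsWithin_mono (0 : ℝ) (fun x (hx : x ∈ Set.Ioi (0 : ℝ)) => (ne_of_gt hx : x ≠ 0)))
  have h2 := h.log one_ne_zero
  rw [Real.log_one] at h2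
  refine h2.congr' ?_
  filter_upwards [self_mem_nhdsWithin] with δ hδ
  have hδ' : 0 < δ := hδ
  have : 0 < 1 - Real.exp (-δ) := by simpa using hδ'
  rw [← Real.log_div this.ne' hδ'.ne']
  simp [slope_def_field]

theorem tendsto_log_log_floor_exp_sub_log_floor :
    Tendsto (fun u : ℝ => Real.log (Real.log ⌊Real.exp u⌋₊) - Real.log ⌊u⌋₊) atTop (nhds 0) := by
  have hfloor : Tendsto (fun u : ℝ => (⌊u⌋₊ : ℝ) / u) atTop (nhds 1) := tendsto_nat_floor_div_atTop
  have h1 : Tendsto (fun u : ℝ => Real.log (⌊Real.exp u⌋₊ / Real.exp u)) atTop (nhds 0) := by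
    simpa using (hfloor.comp Real.tendsto_exp_atTop).log one_ne_zero
  have h2 : Tendsto (fun u : ℝ => (1 + Real.log (⌊Real.exp u⌋₊ / Real.exp u) * u⁻¹) /
      ((⌊u⌋₊ : ℝ) / u)) atTop (nhds 1) := by
    have h := ((h1.mul tendsto_inv_atTop_zero).const_add 1).div hfloor one_ne_zero
    rw [zero_mul, add_zero, div_one] at h
    exact h
  have h3 := h2.log one_ne_zero
  rw [Real.log_one] at h3
  refine h3.congr' ?_
  filter_upwards [eventually_ge_atTop 2] with u hu
  have hm : 2 ≤ ⌊Real.exp u⌋₊ := Nat.le_floor (by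
    push_cast
    linarith [Real.add_one_le_exp u])
  have hm' : (2 : ℝ) ≤ ⌊Real.exp u⌋₊ := by exact_mod_cast hm
  have hk : 2 ≤ ⌊u⌋₊ := Nat.le_floor (by exact_mod_cast hu)
  have hk' : (2 : ℝ) ≤ ⌊u⌋₊ := by exact_mod_cast hk
  have hlog : 0 < Real.log ⌊Real.exp u⌋₊ := Real.log_pos (by linarith)
  rw [← Real.log_div hlog.ne' (by linarith), Real.log_div (by linarith) (Real.exp_pos u).ne',
    Real.log_exp]
  congr 1
  field_simp
  ring

theorem abs_sum_primesLE_sub_harmonic_le_of_le {u U : ℝ} (h : u ≤ U) :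
    |∑ p ∈ Nat.primesLE ⌊Real.exp u⌋₊, 1 / (p : ℝ) - harmonic ⌊u⌋₊| ≤
      ∑ p ∈ Nat.primesLE ⌊Real.exp U⌋₊, 1 / (p : ℝ) + harmonic ⌊U⌋₊ := by
  have h1 : ∑ p ∈ Nat.primesLE ⌊Real.exp u⌋₊, 1 / (p : ℝ) ≤
      ∑ p ∈ Nat.primesLE ⌊Real.exp U⌋₊, 1 / (p : ℝ) := by
    refine Finset.sum_le_sum_of_subset_of_nonneg (fun p hp => ?_) fun _ _ _ => by positivity
    rw [Nat.mem_primesLE] at hp ⊢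
    exact ⟨hp.1.trans (Nat.floor_mono (Real.exp_le_exp.2 h)), hp.2⟩
  have h2 : (harmonic ⌊u⌋₊ : ℝ) ≤ harmonic ⌊U⌋₊ := by
    have : harmonic ⌊u⌋₊ ≤ harmonic ⌊U⌋₊ :=
      Finset.sum_le_sum_of_subset_of_nonneg
        (Finset.range_mono (Nat.floor_mono h)) fun _ _ _ => by positivity
    exact_mod_cast this
  have h3 : 0 ≤ ∑ p ∈ Nat.primesLE ⌊Real.exp u⌋₊, 1 / (p : ℝ) :=
    Finset.sum_nonneg fun _ _ => by positivity
  have h4 : (0 : ℝ) ≤ harmonic ⌊u⌋₊ := by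
    have : 0 ≤ harmonic ⌊u⌋₊ := Finset.sum_nonneg fun _ _ => by positivity
    exact_mod_cast this
  rw [abs_le]
  constructor <;> linarith

theorem integral_exp_neg_mul_sum_primes_sub_harmonic {δ : ℝ} (hδ : 0 < δ) :
    ∫ t in Set.Ioi (0 : ℝ), Real.exp (-t) *
        (∑ p ∈ Nat.primesLE ⌊Real.exp (t / δ)⌋₊, 1 / (p : ℝ) - harmonic ⌊t / δ⌋₊) =
      ∑' p : Nat.Primes, (p : ℝ) ^ (-(1 + δ)) + Real.log (1 - Real.exp (-δ)) := by
  set c : Nat.Primes ⊕ ℕ → ℝ :=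
    Sum.elim (fun p => 1 / ((p : ℕ) : ℝ)) (fun n => -(1 / ((n : ℝ) + 1)))
  set l : Nat.Primes ⊕ ℕ → ℝ :=
    Sum.elim (fun p => Real.log (p : ℕ)) (fun n => (n : ℝ) + 1)
  have hl : ∀ i, 0 ≤ l i := by
    rintro (p | n)
    · exact Real.log_natCast_nonneg p
    · exact n.cast_add_one_pos.le
  have hP : ∀ p : Nat.Primes, 1 / ((p : ℕ) : ℝ) * Real.exp (-(δ * Real.log (p : ℕ))) =
      ((p : ℕ) : ℝ) ^ (-(1 + δ)) := fun p => by
    have hp : (0 : ℝ) < (p : ℕ) := by exact_mod_cast p.prop.pos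
    rw [neg_add, Real.rpow_add hp, Real.rpow_neg_one, one_div, Real.rpow_def_of_pos hp (-δ)]
    ring_nf
  have hN : ∀ n : ℕ, 1 / ((n : ℝ) + 1) * Real.exp (-(δ * (n + 1))) =
      Real.exp (-δ) ^ (n + 1) / (n + 1) := fun n => by
    rw [← Real.exp_nat_mul]
    push_cast
    ring_nf
  have hPsum : HasSum (fun p : Nat.Primes => ((p : ℕ) : ℝ) ^ (-(1 + δ)))
      (∑' p : Nat.Primes, (p : ℝ) ^ (-(1 + δ))) :=
    (Nat.Primes.summable_rpow.2 (by linarith)).hasSum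
  have hNsum := hasSum_pow_div_log_of_abs_lt_one (x := Real.exp (-δ)) (by
    rw [abs_of_pos (Real.exp_pos _), Real.exp_lt_one_iff]
    linarith)
  have hs : Summable fun i => |c i| * Real.exp (-(δ * l i)) := by
    refine (HasSum.sum (hPsum.congr_fun fun p => ?_) (hNsum.congr_fun fun n => ?_)).summable
    · rw [← hP]
      simp [c, l]
    · rw [← hN]
      simp only [c, l, Function.comp_apply, Sum.elim_inr, abs_neg]
      rw [abs_of_pos (by positivity)]
  have h1 := hasSum_mul_exp_integral hl hδ hs
  have h2 : HasSum (fun i => c i * Real.exp (-(δ * l i)))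
      (∑' p : Nat.Primes, (p : ℝ) ^ (-(1 + δ)) + Real.log (1 - Real.exp (-δ))) := by
    refine HasSum.sum (hPsum.congr_fun fun p => ?_) ?_
    · exact hP p
    · convert! hNsum.neg using 1
      · ext n
        rw [← hN]
        simp [c, l]
      · rw [neg_neg]
  rw [← h1.unique h2]
  refine MeasureTheory.setIntegral_congr_fun measurableSet_Ioi fun t ht => ?_
  have h3 : HasSum (fun i => if l i ≤ t / δ then c i else 0)
      (∑ p ∈ Nat.primesLE ⌊Real.exp (t / δ)⌋₊, 1 / (p : ℝ) + -(harmonic ⌊t / δ⌋₊ : ℝ)) :=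
    HasSum.sum (hasSum_primes_ite_log_le (t / δ))
      (hasSum_ite_add_one_le (div_pos ht hδ).le)
  simp only [h3.tsum_eq, sub_eq_add_neg]

/-- The constant in Mertens' second theorem. -/
theorem tendsto_sum_one_div_sub_log_log :
    Tendsto (fun n : ℕ => ∑ p ∈ Nat.primesLE n, 1 / (p : ℝ) - Real.log (Real.log n)) atTop
      (nhds (Real.eulerMascheroniConstant -
        ∑' p : Nat.Primes, (-Real.log (1 - (p : ℝ) ^ (-1 : ℝ)) - (p : ℝ) ^ (-1 : ℝ)))) := by
  obtain ⟨C, hC⟩ := exists_tendsto_sum_one_div_sub_log_log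
  set R := ∑' p : Nat.Primes, (-Real.log (1 - (p : ℝ) ^ (-1 : ℝ)) - (p : ℝ) ^ (-1 : ℝ)) with hR
  set A : ℝ → ℝ := fun u =>
    ∑ p ∈ Nat.primesLE ⌊Real.exp u⌋₊, 1 / (p : ℝ) - harmonic ⌊u⌋₊ with hA
  have hlim : Tendsto A atTop (nhds (C - Real.eulerMascheroniConstant)) := by
    have h1 := hC.comp (tendsto_nat_floor_atTop.comp Real.tendsto_exp_atTop)
    have h2 := Real.tendsto_harmonic_sub_log.comp (tendsto_nat_floor_atTop (α := ℝ))
    have h3 := (h1.sub h2).add tendsto_log_log_floor_exp_sub_log_floor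
    rw [add_zero] at h3
    refine h3.congr fun u => ?_
    simp only [Function.comp_apply, hA]
    ring
  have hmeas : Measurable A := by
    refine Measurable.sub ?_ ?_
    · exact (measurable_from_nat (f := fun n => ∑ p ∈ Nat.primesLE n, 1 / (p : ℝ))).comp
        (Nat.measurable_floor.comp Real.measurable_exp)
    · exact (measurable_from_nat (f := fun n => (harmonic n : ℝ))).comp Nat.measurable_floor
  obtain ⟨M, hM⟩ : ∃ M, ∀ u, 0 < u → |A u| ≤ M := by
    obtain ⟨U, hU⟩ := eventually_atTop.1
      (hlim.abs.eventually_le_const (lt_add_one |C - Real.eulerMascheroniConstant|))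
    refine ⟨max (∑ p ∈ Nat.primesLE ⌊Real.exp U⌋₊, 1 / (p : ℝ) + harmonic ⌊U⌋₊)
      (|C - Real.eulerMascheroniConstant| + 1), fun u _ => ?_⟩
    rcases le_total u U with h | h
    · exact le_max_of_le_left (abs_sum_primesLE_sub_harmonic_le_of_le h)
    · exact le_max_of_le_right (hU u h)
  have h1 := tendsto_integral_exp_neg_mul_comp_div hmeas hM hlim
  have h2 := tendsto_tsum_primes_rpow_add_log.add tendsto_log_one_sub_exp_neg_sub_log
  rw [add_zero, ← hR] at h2
  have h3 := h1.congr' (f₂ := fun δ : ℝ =>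
      ∑' p : Nat.Primes, (p : ℝ) ^ (-(1 + δ)) + Real.log (1 - Real.exp (-δ))) (by
    filter_upwards [self_mem_nhdsWithin] with δ hδ
    exact integral_exp_neg_mul_sum_primes_sub_harmonic hδ)
  have h4 : C - Real.eulerMascheroniConstant = -R :=
    tendsto_nhds_unique h3 (h2.congr fun δ => by ring)
  have h5 : C = Real.eulerMascheroniConstant - R := by linarith
  rwa [← h5]

theorem tendsto_sum_primesLE_of_summable {f : ℕ → ℝ} (hf : Summable fun p : Nat.Primes => f p) :
    Tendsto (fun n : ℕ => ∑ p ∈ Nat.primesLE n, f p) atTop (nhds (∑' p : Nat.Primes, f p)) := by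
  have h := (hasSum_subtype_iff_indicator (f := f) (s := {p : ℕ | p.Prime})).1 hf.hasSum
  refine (h.tendsto_sum_nat.comp (tendsto_add_atTop_nat 1)).congr fun n => ?_
  rw [Nat.primesLE_eq_filter_range, Finset.sum_filter]
  exact Finset.sum_congr rfl fun p _ => Set.indicator_apply _ _ _

/-- **Mertens' third theorem**. -/
theorem tendsto_prod_one_sub_inv_mul_log :
    Tendsto (fun n : ℕ => (∏ p ∈ Nat.primesLE n, (1 - (p : ℝ)⁻¹)) * Real.log n) atTop
      (nhds (Real.exp (-Real.eulerMascheroniConstant))) := by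
  have hs := tendsto_sum_primesLE_of_summable
    (f := fun p => -Real.log (1 - (p : ℝ) ^ (-1 : ℝ)) - (p : ℝ) ^ (-1 : ℝ))
    (summable_neg_log_one_sub_sub_primes le_rfl)
  have h := (tendsto_sum_one_div_sub_log_log.add hs).neg.rexp
  rw [sub_add_cancel] at h
  refine h.congr' ?_
  filter_upwards [eventually_ge_atTop 2] with n hn
  have hlog : 0 < Real.log n := Real.log_pos (by exact_mod_cast hn)
  have hpos : ∀ p ∈ Nat.primesLE n, 0 < 1 - (p : ℝ)⁻¹ := fun p hp => by
    have : (1 : ℝ) < p := by exact_mod_cast (Nat.prime_of_mem_primesLE hp).one_lt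
    exact sub_pos.2 (inv_lt_one_of_one_lt₀ this)
  rw [← Real.exp_log (mul_pos (Finset.prod_pos hpos) hlog),
    Real.log_mul (Finset.prod_pos hpos).ne' hlog.ne', Real.log_prod fun p hp => (hpos p hp).ne']
  simp only [Real.rpow_neg_one, one_div, Finset.sum_sub_distrib, Finset.sum_neg_distrib]
  ring_nf

theorem one_sub_inv_natCast_nonneg (p : ℕ) : 0 ≤ 1 - (p : ℝ)⁻¹ :=
  sub_nonneg.2 p.cast_inv_le_one

theorem one_sub_inv_natCast_le_one (p : ℕ) : 1 - (p : ℝ)⁻¹ ≤ 1 :=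
  sub_le_self _ (by positivity)

theorem totient_div_eq_prod {n : ℕ} (hn : n ≠ 0) :
    (Nat.totient n : ℝ) / n = ∏ p ∈ n.primeFactors, (1 - (p : ℝ)⁻¹) := by
  have h : ((Nat.totient n : ℚ) : ℝ) = ((n * ∏ p ∈ n.primeFactors, (1 - (p : ℚ)⁻¹) : ℚ) : ℝ) := by
    rw [Nat.totient_eq_mul_prod_factors]
  push_cast at h
  rw [h, mul_div_cancel_left₀ _ (by exact_mod_cast hn)]

theorem card_primeFactors_gt_mul_log_le {n : ℕ} (hn : n ≠ 0) {y : ℝ} (hy : 0 < y) :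
    ((n.primeFactors.filter fun p : ℕ => y < p).card : ℝ) * Real.log y ≤ Real.log n := by
  set s := n.primeFactors.filter fun p : ℕ => y < p with hs
  have h1 : ∏ p ∈ s, p ≤ n := Nat.le_of_dvd (Nat.pos_of_ne_zero hn)
    ((Finset.prod_dvd_prod_of_subset _ _ _ (Finset.filter_subset _ _)).trans
      (Nat.prod_primeFactors_dvd n))
  have h2 : y ^ s.card ≤ n := by
    calc y ^ s.card = ∏ _p ∈ s, y := by rw [Finset.prod_const]
      _ ≤ ∏ p ∈ s, (p : ℝ) := Finset.prod_le_prod (fun _ _ => hy.le) fun p hp =>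
          (Finset.mem_filter.1 hp).2.le
      _ = ((∏ p ∈ s, p : ℕ) : ℝ) := (Nat.cast_prod _ _).symm
      _ ≤ n := Nat.cast_le.2 h1
  rw [← Real.log_pow]
  exact Real.log_le_log (by positivity) h2

/-- The prime factors of `n` beyond `log n` contribute negligibly to `φ(n) / n`. -/
theorem prod_mul_one_sub_le_totient_div {n : ℕ} (hn : 1 < Real.log n) :
    (∏ p ∈ Nat.primesLE ⌊Real.log n⌋₊, (1 - (p : ℝ)⁻¹)) * (1 - (Real.log (Real.log n))⁻¹) ≤
      (Nat.totient n : ℝ) / n := by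
  have hn0 : n ≠ 0 := by
    rintro rfl
    norm_num at hn
  set y := Real.log n with hy
  have hy0 : 0 < y := by linarith
  have hly : 0 < Real.log y := Real.log_pos hn
  rw [totient_div_eq_prod hn0,
    ← Finset.prod_filter_not_mul_prod_filter n.primeFactors (fun p : ℕ => y < p)]
  have hsmall : ∏ p ∈ Nat.primesLE ⌊y⌋₊, (1 - (p : ℝ)⁻¹) ≤
      ∏ p ∈ n.primeFactors.filter (fun p : ℕ => ¬ y < p), (1 - (p : ℝ)⁻¹) := by
    rw [← Finset.prod_sdiff (s₁ := n.primeFactors.filter (fun p : ℕ => ¬ y < p))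
      (s₂ := Nat.primesLE ⌊y⌋₊) fun p hp => ?_]
    · exact mul_le_of_le_one_left (Finset.prod_nonneg fun p _ => one_sub_inv_natCast_nonneg p)
        (Finset.prod_le_one (fun p _ => one_sub_inv_natCast_nonneg p)
          fun p _ => one_sub_inv_natCast_le_one p)
    · rw [Finset.mem_filter, not_lt] at hp
      exact Nat.mem_primesLE.2 ⟨Nat.le_floor hp.2, Nat.prime_of_mem_primeFactors hp.1⟩
  have hlarge : 1 - (Real.log y)⁻¹ ≤
      ∏ p ∈ n.primeFactors.filter (fun p : ℕ => y < p), (1 - (p : ℝ)⁻¹) := by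
    set s := n.primeFactors.filter (fun p : ℕ => y < p) with hs
    have hk : (s.card : ℝ) * Real.log y ≤ y := card_primeFactors_gt_mul_log_le hn0 hy0
    have hyi : y⁻¹ ≤ 1 := inv_le_one_of_one_le₀ hn.le
    calc 1 - (Real.log y)⁻¹ ≤ 1 + s.card * (-y⁻¹) := by
          have : (s.card : ℝ) * y⁻¹ ≤ (Real.log y)⁻¹ := by
            rw [← div_eq_mul_inv, div_le_iff₀ hy0, ← div_eq_inv_mul, le_div_iff₀ hly]
            exact hk
          linarith
      _ ≤ (1 + -y⁻¹) ^ s.card := one_add_mul_le_pow (by linarith) _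
      _ = ∏ _p ∈ s, (1 - y⁻¹) := by rw [Finset.prod_const, sub_eq_add_neg]
      _ ≤ _ := Finset.prod_le_prod (fun _ _ => sub_nonneg.2 hyi) fun p hp =>
          sub_le_sub_left (inv_anti₀ hy0 (Finset.mem_filter.1 hp).2.le) _
  calc _ ≤ (∏ p ∈ Nat.primesLE ⌊y⌋₊, (1 - (p : ℝ)⁻¹)) *
        ∏ p ∈ n.primeFactors.filter (fun p : ℕ => y < p), (1 - (p : ℝ)⁻¹) :=
        mul_le_mul_of_nonneg_left hlarge
          (Finset.prod_nonneg fun p _ => one_sub_inv_natCast_nonneg p)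
    _ ≤ _ := mul_le_mul_of_nonneg_right hsmall
        (Finset.prod_nonneg fun p _ => one_sub_inv_natCast_nonneg p)

theorem eventually_lt_totient_mul_div {a : ℝ}
    (ha : a < Real.exp (-Real.eulerMascheroniConstant)) :
    ∀ᶠ n : ℕ in atTop, a < (Nat.totient n : ℝ) * Real.log (Real.log n) / n := by
  have hlog : Tendsto (fun n : ℕ => Real.log n) atTop atTop :=
    Real.tendsto_log_atTop.comp tendsto_natCast_atTop_atTop
  have hloglog := Real.tendsto_log_atTop.comp hlog
  have h := (tendsto_prod_one_sub_inv_mul_log.comp (tendsto_nat_floor_atTop.comp hlog)).mul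
    (hloglog.inv_tendsto_atTop.const_sub 1)
  rw [sub_zero, mul_one] at h
  filter_upwards [h.eventually_const_lt ha, hlog.eventually_gt_atTop 1,
    hloglog.eventually_ge_atTop 1] with n h1 h2 h3
  refine h1.trans_le ?_
  simp only [Function.comp_apply, Pi.inv_apply] at h3 ⊢
  have h4 : (1 : ℝ) ≤ ⌊Real.log n⌋₊ := by exact_mod_cast Nat.le_floor (by exact_mod_cast h2.le)
  have h5 : Real.log ⌊Real.log n⌋₊ ≤ Real.log (Real.log n) :=
    Real.log_le_log (by linarith) (Nat.floor_le (by linarith))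
  have h6 : 0 ≤ 1 - (Real.log (Real.log n))⁻¹ := sub_nonneg.2 (inv_le_one_of_one_le₀ h3)
  have h7 : 0 ≤ ∏ p ∈ Nat.primesLE ⌊Real.log n⌋₊, (1 - (p : ℝ)⁻¹) :=
    Finset.prod_nonneg fun p _ => one_sub_inv_natCast_nonneg p
  calc _ = (∏ p ∈ Nat.primesLE ⌊Real.log n⌋₊, (1 - (p : ℝ)⁻¹)) *
        (1 - (Real.log (Real.log n))⁻¹) * Real.log ⌊Real.log n⌋₊ := by ring
    _ ≤ (Nat.totient n : ℝ) / n * Real.log (Real.log n) :=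
        mul_le_mul (prod_mul_one_sub_le_totient_div h2) h5 (Real.log_nonneg h4) (by positivity)
    _ = _ := by ring

theorem frequently_totient_mul_div_lt {b : ℝ}
    (hb : Real.exp (-Real.eulerMascheroniConstant) < b) :
    ∃ᶠ n : ℕ in atTop, (Nat.totient n : ℝ) * Real.log (Real.log n) / n < b := by
  have hprim : Tendsto primorial atTop atTop :=
    tendsto_atTop_mono (fun _ => le_primorial_self) tendsto_id
  refine hprim.frequently (Eventually.frequently ?_)
  have hlog : Tendsto (fun n : ℕ => Real.log n) atTop atTop :=
    Real.tendsto_log_atTop.comp tendsto_natCast_atTop_atTop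
  have h := tendsto_prod_one_sub_inv_mul_log.mul
    ((hlog.inv_tendsto_atTop.mul_const (Real.log (Real.log 4))).const_add 1)
  rw [zero_mul, add_zero, mul_one] at h
  filter_upwards [h.eventually_lt_const hb, eventually_ge_atTop 2] with k h1 hk
  refine lt_of_le_of_lt ?_ h1
  have hk' : (2 : ℝ) ≤ k := by exact_mod_cast hk
  have hlk : 0 < Real.log k := Real.log_pos (by linarith)
  have hl4 : 0 < Real.log 4 := Real.log_pos (by norm_num)
  have hp2 : (2 : ℝ) ≤ primorial k := by exact_mod_cast hk.trans le_primorial_self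
  have h2 : Real.log (primorial k) ≤ k * Real.log 4 := by
    rw [← Real.log_pow]
    exact Real.log_le_log (by linarith) (by exact_mod_cast primorial_le_four_pow k)
  have h3 : Real.log (Real.log (primorial k)) ≤ Real.log k + Real.log (Real.log 4) := by
    rw [← Real.log_mul (by linarith) hl4.ne']
    exact Real.log_le_log (Real.log_pos (by linarith)) h2
  rw [mul_div_right_comm, totient_div_eq_prod (primorial_ne_zero k), primeFactors_primorial]
  refine (mul_le_mul_of_nonneg_left h3
    (Finset.prod_nonneg fun p _ => one_sub_inv_natCast_nonneg p)).trans_eq ?_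
  simp only [Pi.inv_apply]
  field_simp

/-- **Landau's theorem.** `liminf φ(n) log log n / n = e^{-γ}`. -/
theorem liminf_totient_mul_div_eq_exp_neg_gamma :
    Filter.liminf
      (fun n : ℕ => (Nat.totient n : ℝ) * Real.log (Real.log n) / n)
      Filter.atTop = Real.exp (-Real.eulerMascheroniConstant) := by
  have hbdd : IsBoundedUnder (· ≥ ·) atTop
      (fun n : ℕ => (Nat.totient n : ℝ) * Real.log (Real.log n) / n) :=
    ⟨0, eventually_map.2 ((eventually_lt_totient_mul_div (Real.exp_pos _)).mono fun _ h => h.le)⟩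
  have hcobdd : IsCoboundedUnder (· ≥ ·) atTop
      (fun n : ℕ => (Nat.totient n : ℝ) * Real.log (Real.log n) / n) :=
    IsCoboundedUnder.of_frequently_le
      ((frequently_totient_mul_div_lt (lt_add_one _)).mono fun _ h => h.le)
  apply le_antisymm
  · refine le_of_forall_gt_imp_ge_of_dense fun b hb => ?_
    exact liminf_le_of_frequently_le
      ((frequently_totient_mul_div_lt hb).mono fun _ h => h.le) hbdd
  · refine le_of_forall_lt_imp_le_of_dense fun a ha => ?_
    exact le_liminf_of_le hcobdd ((eventually_lt_totient_mul_div ha).mono fun _ h => h.le)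
end
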